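/- Let Φ be a positive linear trace-non-increasing map from 𝔗(ℋ) to 𝔗(ℋ'). The following are equivalent: (i) the output entropy A ↦ H_Φ(A) is (finite and) continuous on the set 𝔗₊¹(ℋ) of positive trace-class operators of rank ≤ 1; (ii) for every natural k the k-order approximator A ↦ H_Φ^k(A) is continuous on 𝔗₊(ℋ); (iii) A ↦ H_Φ(A) is continuous on every subset of 𝔗₊(ℋ) on which the quantum entropy is continuous. Moreover, property (i) is equivalent to continuity and boundedness of ρ ↦ H_Φ(ρ) on the set of pure states extr 𝔖(ℋ). -/

import Mathlib

open scoped ENNReal NNReal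
open Filter Topology Classical
attribute [local instance] Classical.propDecidable

noncomputable section

namespace QIT

section Defs

variable {E F G : Type*}
variable [NormedAddCommGroup E] [InnerProductSpace ℂ E] [CompleteSpace E]
variable [NormedAddCommGroup F] [InnerProductSpace ℂ F] [CompleteSpace F]
variable [NormedAddCommGroup G] [InnerProductSpace ℂ G] [CompleteSpace G]

/-- The real part of `⟪x, A x⟫`. -/
def qf (A : E →L[ℂ] E) (x : E) : ℝ := (inner ℂ x (A x) : ℂ).re

/-- The trace of a positive operator, as the supremum of finite diagonal sums over
finite orthonormal families.  For positive operators this coincides with the usual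
trace (with value `∞` when the operator is not trace class). -/
def traceENN (A : E →L[ℂ] E) : ℝ≥0∞ :=
  ⨆ (n : ℕ) (e : Fin n → E) (_ : Orthonormal ℂ e), ∑ i, ENNReal.ofReal (qf A (e i))

/-- The trace norm `‖A‖₁`, as the supremum of `∑ |⟪e i, A (f i)⟫|` over pairs of finite
orthonormal families; it is finite exactly on trace-class operators. -/
def traceNorm (A : E →L[ℂ] E) : ℝ≥0∞ :=
  ⨆ (n : ℕ) (e : Fin n → E) (f : Fin n → E) (_ : Orthonormal ℂ e) (_ : Orthonormal ℂ f),
    ∑ i, ENNReal.ofReal ‖(inner ℂ (e i) (A (f i)) : ℂ)‖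

/-- `A` is a trace-class operator. -/
def IsTC (A : E →L[ℂ] E) : Prop := traceNorm A ≠ ∞

/-- The cone `𝔗₊(E)` of positive trace-class operators. -/
def posTC (E : Type*) [NormedAddCommGroup E] [InnerProductSpace ℂ E] [CompleteSpace E] :
    Set (E →L[ℂ] E) := {A | A.IsPositive ∧ IsTC A}

/-- The set `𝔖(E)` of states (density operators). -/
def states (E : Type*) [NormedAddCommGroup E] [InnerProductSpace ℂ E] [CompleteSpace E] :
    Set (E →L[ℂ] E) := {A | A.IsPositive ∧ traceENN A = 1}

/-- The extended classical entropy `H({x_i}) = ∑ η(x_i) − η(∑ x_i)` of a nonnegative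
summable family, written in the equivalent homogeneous form `(∑ x) · H({x_i/∑x})`. -/
def clEntropy {ι : Type*} (x : ι → ℝ) : ℝ≥0∞ :=
  ENNReal.ofReal (∑' i, x i) *
    ∑' i, ENNReal.ofReal (Real.negMulLog (x i / (∑' j, x j)))

/-- An orthonormal subset with dense span (an orthonormal basis, as a set). -/
def IsONB (s : Set E) : Prop :=
  Orthonormal ℂ ((↑) : s → E) ∧ Dense ((Submodule.span ℂ s : Submodule ℂ E) : Set E)

/-- The quantum (von Neumann) entropy `H(A) = Tr η(A) − η(Tr A)` of a positive trace-class
operator, realized as the infimum over all orthonormal bases of the classical entropy of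
the diagonal of `A` (the infimum is attained on an eigenbasis of `A`). -/
def qEntropy (A : E →L[ℂ] E) : ℝ≥0∞ :=
  ⨅ (s : Set E) (_ : IsONB s), clEntropy fun v : s => qf A v

theorem exists_isONB (E : Type*) [NormedAddCommGroup E] [InnerProductSpace ℂ E]
    [CompleteSpace E] : ∃ s : Set E, IsONB s := by
  obtain ⟨w, b, hb⟩ := exists_hilbertBasis ℂ E
  refine ⟨w, ?_, ?_⟩
  · have h := b.orthonormal
    rwa [hb] at h
  · have h := b.dense_span
    rw [hb, Subtype.range_coe] at h
    rwa [Submodule.dense_iff_topologicalClosure_eq_top]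

/-- A fixed orthonormal basis (as a set). -/
def stdONB (E : Type*) [NormedAddCommGroup E] [InnerProductSpace ℂ E] [CompleteSpace E] :
    Set E := (exists_isONB E).choose

/-- The `ℂ`-valued trace, computed in a fixed orthonormal basis; for trace-class
operators it does not depend on the choice of the basis. -/
def traceC (A : E →L[ℂ] E) : ℂ := ∑' v : stdONB E, (inner ℂ (v : E) (A v) : ℂ)

/-- Continuity (including finiteness) of an `ℝ≥0∞`-valued function on a subset of
operators, with respect to the trace-norm distance. -/
def ContOn (f : (E →L[ℂ] E) → ℝ≥0∞) (𝒜 : Set (E →L[ℂ] E)) : Prop :=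
  (∀ A ∈ 𝒜, f A ≠ ∞) ∧
  ∀ A ∈ 𝒜, ∀ ε : ℝ, 0 < ε → ∃ δ : ℝ, 0 < δ ∧
    ∀ B ∈ 𝒜, traceNorm (B - A) < ENNReal.ofReal δ → |(f B).toReal - (f A).toReal| < ε

/-- Continuity of a real-valued function on a subset of operators with respect to the
trace-norm distance. -/
def RContOn (g : (E →L[ℂ] E) → ℝ) (𝒜 : Set (E →L[ℂ] E)) : Prop :=
  ∀ A ∈ 𝒜, ∀ ε : ℝ, 0 < ε → ∃ δ : ℝ, 0 < δ ∧
    ∀ B ∈ 𝒜, traceNorm (B - A) < ENNReal.ofReal δ → |g B - g A| < ε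

/-- Boundedness of an `ℝ≥0∞`-valued function on a set. -/
def BddOn (f : (E →L[ℂ] E) → ℝ≥0∞) (𝒜 : Set (E →L[ℂ] E)) : Prop :=
  ∃ C : ℝ, ∀ A ∈ 𝒜, f A ≤ ENNReal.ofReal C

/-- Convergence of a sequence of operators in the trace norm. -/
def TendstoTN (A : ℕ → (E →L[ℂ] E)) (A₀ : E →L[ℂ] E) : Prop :=
  ∀ ε : ℝ, 0 < ε → ∃ N : ℕ, ∀ n ≥ N, traceNorm (A n - A₀) < ENNReal.ofReal ε

/-- A positive linear map from the trace class of `E` to the trace class of `F`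
(the values of `toFun` outside the trace class are irrelevant). -/
structure TraceMap (E F : Type*) [NormedAddCommGroup E] [InnerProductSpace ℂ E]
    [CompleteSpace E] [NormedAddCommGroup F] [InnerProductSpace ℂ F] [CompleteSpace F] where
  toFun : (E →L[ℂ] E) → (F →L[ℂ] F)
  map_add : ∀ A B, IsTC A → IsTC B → toFun (A + B) = toFun A + toFun B
  map_smul : ∀ (c : ℂ) A, IsTC A → toFun (c • A) = c • toFun A
  maps_tc : ∀ A, IsTC A → IsTC (toFun A)
  pos : ∀ A, IsTC A → A.IsPositive → (toFun A).IsPositive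

/-- A trace-non-increasing map. -/
def TraceMap.TNI (Φ : TraceMap E F) : Prop :=
  ∀ A, IsTC A → A.IsPositive → traceENN (Φ.toFun A) ≤ traceENN A

/-- A trace-preserving map. -/
def TraceMap.TP (Φ : TraceMap E F) : Prop :=
  ∀ A, IsTC A → A.IsPositive → traceENN (Φ.toFun A) = traceENN A

/-- A map bounded with respect to the trace norm. -/
def TraceMap.Bounded (Φ : TraceMap E F) : Prop :=
  ∃ C : ℝ≥0, ∀ A, traceNorm (Φ.toFun A) ≤ (C : ℝ≥0∞) * traceNorm A

/-- The output entropy `H_Φ = H ∘ Φ`. -/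
def outEntropy (Φ : TraceMap E F) (A : E →L[ℂ] E) : ℝ≥0∞ := qEntropy (Φ.toFun A)

/-- The rank-one operator `|x⟩⟨x|`. -/
def rankOne (x : E) : E →L[ℂ] E := (innerSL ℂ x).smulRight x

/-- The rank-one operator `|x⟩⟨y|`. -/
def rankOneM (x y : E) : E →L[ℂ] E := (innerSL ℂ y).smulRight x

end Defs

section Defs2

variable {E F G : Type*}
variable [NormedAddCommGroup E] [InnerProductSpace ℂ E] [CompleteSpace E]
variable [NormedAddCommGroup F] [InnerProductSpace ℂ F] [CompleteSpace F]
variable [NormedAddCommGroup G] [InnerProductSpace ℂ G] [CompleteSpace G]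

/-- The completely positive map `A ↦ ∑ᵢ Vᵢ A Vᵢ*` defined by a sequence of Kraus
operators. -/
def krausMap (V : ℕ → (E →L[ℂ] F)) (A : E →L[ℂ] E) : F →L[ℂ] F :=
  ∑' i, V i ∘L A ∘L ContinuousLinearMap.adjoint (V i)

/-- The Kraus condition `∑ᵢ Vᵢ* Vᵢ ≤ I` (all partial sums are dominated by `I`). -/
def KrausTNI (V : ℕ → (E →L[ℂ] F)) : Prop :=
  ∀ n : ℕ,
    ((1 : E →L[ℂ] E) - ∑ i ∈ Finset.range n, ContinuousLinearMap.adjoint (V i) ∘L V i).IsPositive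

/-- The Kraus condition `∑ᵢ Vᵢ* Vᵢ = I` (strong convergence), i.e. trace preservation. -/
def KrausTP (V : ℕ → (E →L[ℂ] F)) : Prop :=
  ∀ x : E, HasSum (fun i => (ContinuousLinearMap.adjoint (V i)) (V i x)) x

/-- `(Φ, Φt)` is a complementary pair of quantum operations: for some Kraus
representation `Φ(·) = ∑ᵢ Vᵢ (·) Vᵢ*` and some orthonormal basis `{bᵢ}` of `G`,
`Φt(A) = ∑_{i,j} Tr[Vᵢ A Vⱼ*] |bᵢ⟩⟨bⱼ|` (characterized by its matrix entries). -/
def IsComplementaryPair (Φ : TraceMap E F) (Φt : TraceMap E G) : Prop :=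
  ∃ (V : ℕ → (E →L[ℂ] F)) (b : HilbertBasis ℕ ℂ G),
    KrausTNI V ∧
    (∀ A, IsTC A → Φ.toFun A = krausMap V A) ∧
    (∀ A, IsTC A → ∀ i j : ℕ,
      (inner ℂ (b i) (Φt.toFun A (b j)) : ℂ) =
        traceC (V i ∘L A ∘L ContinuousLinearMap.adjoint (V j)))

/-- A map (on trace-class operators) preserves continuity of the entropy:
its output entropy is continuous on every subset of the positive trace-class cone on
which the von Neumann entropy is continuous. -/
def PCE (Φf : (E →L[ℂ] E) → (F →L[ℂ] F)) : Prop :=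
  ∀ 𝒜 : Set (E →L[ℂ] E), 𝒜 ⊆ posTC E → ContOn qEntropy 𝒜 →
    ContOn (fun A => qEntropy (Φf A)) 𝒜

/-- `μ` is the sequence of nonzero eigenvalues (with multiplicities, possibly padded by
zeros) of the diagonalizable positive operator `T`, every vector orthogonal to the
eigenvectors being annihilated by `T`. -/
def IsEigenSeq (T : E →L[ℂ] E) (μ : ℕ → ℝ) : Prop :=
  ∃ e : ℕ → E,
    (∀ i j, i ≠ j → (inner ℂ (e i) (e j) : ℂ) = 0) ∧
    (∀ i, (μ i ≠ 0 → ‖e i‖ = 1) ∧ (μ i = 0 → e i = 0)) ∧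
    (∀ i, T (e i) = (μ i : ℂ) • e i) ∧
    (∀ x : E, (∀ i, (inner ℂ (e i) x : ℂ) = 0) → T x = 0)

/-- `ν` is the sequence of singular values of `V` (eigenvalues of `√(V*V)`,
equivalently `ν²` are the eigenvalues of `V*V`). -/
def IsSingularValues (V : E →L[ℂ] F) (ν : ℕ → ℝ) : Prop :=
  (∀ i, 0 ≤ ν i) ∧ IsEigenSeq (ContinuousLinearMap.adjoint V ∘L V) (fun i => ν i ^ 2)

/-- `∑ᵢ e^{−l/νᵢ²}`, the sum being taken over the indices with `νᵢ ≠ 0`. -/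
def expSum (ν : ℕ → ℝ) (l : ℝ) : ℝ≥0∞ :=
  ∑' i, if ν i = 0 then 0 else ENNReal.ofReal (Real.exp (-(l / ν i ^ 2)))

/-- `λ*(V) < ∞`: `V` is compact (automatic here) and `∑ᵢ e^{−l/νᵢ²} < ∞` for some
`l > 0`, where `{νᵢ}` are the singular values of `V`. -/
def LamStarFin (V : E →L[ℂ] F) : Prop :=
  ∃ ν : ℕ → ℝ, IsSingularValues V ν ∧ ∃ l : ℝ, 0 < l ∧ expSum ν l ≠ ∞

/-- `λ*(√S) < ∞` for a positive operator `S` (the singular values of `√S` are the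
square roots of the eigenvalues of `S`). -/
def LamStarSqrtFin (S : E →L[ℂ] E) : Prop :=
  ∃ ν : ℕ → ℝ, (∀ i, 0 ≤ ν i) ∧ IsEigenSeq S (fun i => ν i ^ 2) ∧
    ∃ l : ℝ, 0 < l ∧ expSum ν l ≠ ∞

/-- The value `λ*` associated to a sequence `ν` of singular values: the unique solution
of `∑ᵢ e^{−λ/νᵢ²} = 1` if it exists, and `inf{λ > 0 | ∑ᵢ e^{−λ/νᵢ²} < ∞}` otherwise. -/
def lamStarOf (ν : ℕ → ℝ) : ℝ≥0∞ :=
  if h : ∃ l : ℝ, expSum ν l = 1 then ENNReal.ofReal h.choose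
  else ⨅ (l : ℝ) (_ : 0 < l ∧ expSum ν l ≠ ∞), ENNReal.ofReal l

/-- The parameter `λ*(V) ∈ [0,∞]` of a bounded operator `V`. -/
def lamStar (V : E →L[ℂ] F) : ℝ≥0∞ :=
  if h : ∃ ν : ℕ → ℝ, IsSingularValues V ν then lamStarOf h.choose else ∞

/-- `rank A ≤ k`. -/
def rankLE (A : E →L[ℂ] E) (k : ℕ) : Prop :=
  Module.rank ℂ (LinearMap.range (A : E →ₗ[ℂ] E)) ≤ k

/-- The set `𝔗₊ᵏ(E)` of positive (trace-class) operators of rank at most `k`. -/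
def rankCone (E : Type*) [NormedAddCommGroup E] [InnerProductSpace ℂ E] [CompleteSpace E]
    (k : ℕ) : Set (E →L[ℂ] E) := {A | A.IsPositive ∧ rankLE A k}

/-- A decomposition of `A` into a countable convex combination of positive operators of
rank at most `k`. -/
structure Decomp (k : ℕ) (A : E →L[ℂ] E) where
  π : ℕ → ℝ
  op : ℕ → (E →L[ℂ] E)
  π_nonneg : ∀ i, 0 ≤ π i
  π_sum : HasSum π 1
  op_pos : ∀ i, (op i).IsPositive
  op_rank : ∀ i, rankLE (op i) k
  sum_eq : HasSum (fun i => π i • op i) A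

/-- The `k`-order approximator `H_Φᵏ` of the output entropy of `Φ`. -/
def kApprox (Φf : (E →L[ℂ] E) → (F →L[ℂ] F)) (k : ℕ) (A : E →L[ℂ] E) : ℝ≥0∞ :=
  ⨆ d : Decomp k A, ∑' i, ENNReal.ofReal (d.π i) * qEntropy (Φf (d.op i))

/-- The set of pure states (extreme points of `𝔖(E)`). -/
def pureStates (E : Type*) [NormedAddCommGroup E] [InnerProductSpace ℂ E]
    [CompleteSpace E] : Set (E →L[ℂ] E) := {A | ∃ x : E, ‖x‖ = 1 ∧ A = rankOne x}

end Defs2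

section Tensor

variable (E F G : Type*)
variable [NormedAddCommGroup E] [InnerProductSpace ℂ E] [CompleteSpace E]
variable [NormedAddCommGroup F] [InnerProductSpace ℂ F] [CompleteSpace F]
variable [NormedAddCommGroup G] [InnerProductSpace ℂ G] [CompleteSpace G]

/-- A realization of `G` as the Hilbert tensor product `E ⊗ F`, together with the
tensor product of (bounded) operators. -/
structure TensorData where
  tmul : E → F → G
  add_left : ∀ x y z, tmul (x + y) z = tmul x z + tmul y z
  add_right : ∀ x y z, tmul x (y + z) = tmul x y + tmul x z
  smul_left : ∀ (c : ℂ) x y, tmul (c • x) y = c • tmul x y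
  smul_right : ∀ (c : ℂ) x y, tmul x (c • y) = c • tmul x y
  inner_tmul : ∀ x x' y y',
    (inner ℂ (tmul x y) (tmul x' y') : ℂ) = (inner ℂ x x' : ℂ) * (inner ℂ y y' : ℂ)
  dense_span : Dense ((Submodule.span ℂ {z | ∃ x y, z = tmul x y} : Submodule ℂ G) : Set G)
  omul : (E →L[ℂ] E) → (F →L[ℂ] F) → (G →L[ℂ] G)
  omul_tmul : ∀ A B x y, omul A B (tmul x y) = tmul (A x) (B y)

end Tensor

set_option linter.unusedSectionVars false

section Classical

variable {ι κ : Type*}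

/-- The summand `x log (X / x)` of the extended classical entropy of a family with sum `X`. -/
def entTerm (X x : ℝ) : ℝ := x * (Real.log X - Real.log x)

theorem entTerm_zero_right (X : ℝ) : entTerm X 0 = 0 := by simp [entTerm]

theorem entTerm_nonneg {X x : ℝ} (hx : 0 ≤ x) (hX : x ≤ X) : 0 ≤ entTerm X x := by
  rcases hx.eq_or_lt with rfl | h
  · simp [entTerm]
  · exact mul_nonneg hx (sub_nonneg.2 (Real.log_le_log h hX))

/-- Tangent-line bound for `entTerm`. -/
theorem entTerm_le {X x c : ℝ} (hx : 0 ≤ x) (hX : x ≤ X) (hc : 0 < c) :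
    entTerm X x ≤ c * X - x - x * Real.log c := by
  rcases hx.eq_or_lt with rfl | h
  · simpa [entTerm] using mul_nonneg hc.le hX
  · have hX' : 0 < X := h.trans_le hX
    have h1 := Real.log_le_sub_one_of_pos (x := c * X / x) (by positivity)
    rw [Real.log_div (by positivity) h.ne', Real.log_mul hc.ne' hX'.ne'] at h1
    have h2 := mul_le_mul_of_nonneg_left h1 hx
    have h3 : x * (c * X / x - 1) = c * X - x := by field_simp
    rw [h3] at h2
    unfold entTerm
    linarith

theorem entTerm_add_le {X Y x y : ℝ} (hx : 0 ≤ x) (hX : x ≤ X) (hy : 0 ≤ y) (hY : y ≤ Y) :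
    entTerm X x + entTerm Y y ≤ entTerm (X + Y) (x + y) := by
  rcases (add_nonneg hx hy).eq_or_lt with h | h
  · rw [show x = 0 by linarith, show y = 0 by linarith]
    simp [entTerm]
  · have hXY : 0 < X + Y := by linarith
    have hc : 0 < (x + y) / (X + Y) := by positivity
    have h1 := entTerm_le hx hX hc
    have h2 := entTerm_le hy hY hc
    rw [Real.log_div h.ne' hXY.ne'] at h1 h2
    have h3 : (x + y) / (X + Y) * X + (x + y) / (X + Y) * Y = x + y := by
      rw [← mul_add]; field_simp
    unfold entTerm at *
    nlinarith

theorem le_tsum_self {x : ι → ℝ} (hx : ∀ i, 0 ≤ x i) (hs : Summable x) (i : ι) :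
    x i ≤ ∑' j, x j := hs.le_tsum i fun j _ => hx j

theorem clEntropy_eq {x : ι → ℝ} (hx : ∀ i, 0 ≤ x i) (hs : Summable x) :
    clEntropy x = ∑' i, ENNReal.ofReal (entTerm (∑' j, x j) (x i)) := by
  unfold clEntropy
  rw [← ENNReal.tsum_mul_left]
  refine tsum_congr fun i => ?_
  rw [← ENNReal.ofReal_mul (tsum_nonneg hx)]
  congr 1
  rcases (hx i).eq_or_lt with h | h
  · simp [← h, entTerm]
  · have hX : 0 < ∑' j, x j := h.trans_le (le_tsum_self hx hs i)
    rw [Real.negMulLog, Real.log_div h.ne' hX.ne', entTerm]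
    field_simp
    ring

theorem clEntropy_congr_equiv {x : κ → ℝ} (e : ι ≃ κ) : clEntropy (x ∘ e) = clEntropy x := by
  unfold clEntropy
  have h : (∑' i, (x ∘ e) i) = ∑' j, x j := e.tsum_eq x
  rw [h]
  congr 1
  exact e.tsum_eq fun j => ENNReal.ofReal (Real.negMulLog (x j / ∑' j, x j))

theorem clEntropy_smul {x : ι → ℝ} {c : ℝ} (hc : 0 ≤ c) :
    clEntropy (fun i => c * x i) = ENNReal.ofReal c * clEntropy x := by
  rcases hc.eq_or_lt with rfl | h
  · simp [clEntropy]
  · unfold clEntropy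
    rw [tsum_mul_left, ENNReal.ofReal_mul hc, mul_assoc]
    congr 3 with i
    rw [mul_div_mul_left _ _ h.ne']

theorem clEntropy_add_le {x y : ι → ℝ} (hx : ∀ i, 0 ≤ x i) (hs : Summable x)
    (hy : ∀ i, 0 ≤ y i) (ht : Summable y) :
    clEntropy x + clEntropy y ≤ clEntropy (fun i => x i + y i) := by
  rw [clEntropy_eq hx hs, clEntropy_eq hy ht,
    clEntropy_eq (fun i => add_nonneg (hx i) (hy i)) (hs.add ht), ← ENNReal.tsum_add,
    hs.tsum_add ht]
  refine ENNReal.tsum_le_tsum fun i => ?_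
  rw [← ENNReal.ofReal_add (entTerm_nonneg (hx i) (le_tsum_self hx hs i))
    (entTerm_nonneg (hy i) (le_tsum_self hy ht i))]
  exact ENNReal.ofReal_le_ofReal (entTerm_add_le (hx i) (le_tsum_self hx hs i) (hy i)
    (le_tsum_self hy ht i))

theorem clEntropy_mono {x y : ι → ℝ} (hx : ∀ i, 0 ≤ x i) (hxy : ∀ i, x i ≤ y i)
    (ht : Summable y) : clEntropy x ≤ clEntropy y := by
  have hs : Summable x := ht.of_nonneg_of_le hx hxy
  have h := clEntropy_add_le hx hs (fun i => sub_nonneg.2 (hxy i)) (ht.sub hs)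
  simp only [add_sub_cancel] at h
  exact le_self_add.trans h

/-- A family supported on at most `m` indices with sum `X` has entropy at most `m X`. -/
theorem clEntropy_le_card {x : ι → ℝ} (hx : ∀ i, 0 ≤ x i) (T : Finset ι)
    (hT : ∀ i ∉ T, x i = 0) :
    clEntropy x ≤ T.card * ENNReal.ofReal (∑' i, x i) := by
  have hs : Summable x := summable_of_ne_finset_zero (s := T) hT
  rw [clEntropy_eq hx hs, tsum_eq_sum (s := T) fun i hi => by simp [hT i hi, entTerm]]
  rw [← nsmul_eq_mul, ← Finset.sum_const]
  refine Finset.sum_le_sum fun i _ => ENNReal.ofReal_le_ofReal ?_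
  have := entTerm_le (hx i) (le_tsum_self hx hs i) one_pos
  have := hx i
  simp at *
  linarith

theorem clEntropy_eq_zero_of_subsingleton {x : ι → ℝ} (hx : ∀ i, 0 ≤ x i)
    (h : ∀ i j, x i ≠ 0 → x j ≠ 0 → i = j) : clEntropy x = 0 := by
  by_cases h0 : ∃ i, x i ≠ 0
  · obtain ⟨i, hi⟩ := h0
    have hne : ∀ j, j ≠ i → x j = 0 := fun j hj => by_contra fun hj' => hj (h j i hj' hi)
    have hs : Summable x := summable_of_ne_finset_zero (s := {i})
      fun j hj => hne j (by simpa using hj)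
    rw [clEntropy_eq hx hs, tsum_eq_single i hne, ENNReal.tsum_eq_zero]
    intro j
    by_cases hj : j = i
    · simp [hj, entTerm]
    · simp [hne j hj, entTerm]
  · push Not at h0
    simp [clEntropy, h0]

/-- The entropy does not decrease under (sub)stochastic mixing. -/
theorem clEntropy_le_of_mixing {x : ι → ℝ} {p : κ → ℝ} {D : κ → ι → ℝ} {X : ℝ}
    (hx : ∀ i, 0 ≤ x i) (hX : HasSum x X) (hp : HasSum p X) (hD : ∀ j i, 0 ≤ D j i)
    (hrow : ∀ j, Summable (D j)) (hrow1 : ∀ j, ∑' i, D j i ≤ 1)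
    (hcol : ∀ i, x i ≠ 0 → ∑' j, ENNReal.ofReal (D j i) = 1)
    (hmix : ∀ j, HasSum (fun i => D j i * x i) (p j)) :
    clEntropy x ≤ clEntropy p := by
  have hp0 : ∀ j, 0 ≤ p j := fun j =>
    (hmix j).nonneg fun i => mul_nonneg (hD j i) (hx i)
  rw [clEntropy_eq hx hX.summable, clEntropy_eq hp0 hp.summable, hX.tsum_eq, hp.tsum_eq]
  have hxX : ∀ i, x i ≤ X := fun i => hX.tsum_eq ▸ le_tsum_self hx hX.summable i
  have hpX : ∀ j, p j ≤ X := fun i => hp.tsum_eq ▸ le_tsum_self hp0 hp.summable i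
  have key : ∀ j, ∑' i, ENNReal.ofReal (D j i * entTerm X (x i)) ≤
      ENNReal.ofReal (entTerm X (p j)) := by
    intro j
    rcases (hp0 j).eq_or_lt with h | h
    · have hz : ∀ i, D j i * x i = 0 := by
        have := hmix j
        rw [← h] at this
        exact congrFun ((hasSum_zero_iff_of_nonneg fun i => mul_nonneg (hD j i) (hx i)).1 this)
      have : ∀ i, D j i * entTerm X (x i) = 0 := fun i => by
        rw [entTerm, ← mul_assoc, hz, zero_mul]
      simp [this]
    · have hXpos : 0 < X := h.trans_le (hpX j)
      have hle : ∀ i, D j i * entTerm X (x i) ≤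
          p j * D j i + D j i * x i * (Real.log X - Real.log (p j) - 1) := by
        intro i
        have h1 := entTerm_le (hx i) (hxX i) (div_pos h hXpos)
        rw [Real.log_div h.ne' hXpos.ne', div_mul_cancel₀ _ hXpos.ne'] at h1
        have h2 := mul_le_mul_of_nonneg_left h1 (hD j i)
        linarith
      have hsum : HasSum (fun i => p j * D j i + D j i * x i * (Real.log X - Real.log (p j) - 1))
          (p j * (∑' i, D j i) + p j * (Real.log X - Real.log (p j) - 1)) :=
        ((hrow j).hasSum.mul_left _).add ((hmix j).mul_right _)
      have h0 : ∀ i, 0 ≤ D j i * entTerm X (x i) := fun i =>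
        mul_nonneg (hD j i) (entTerm_nonneg (hx i) (hxX i))
      have hs : Summable fun i => D j i * entTerm X (x i) :=
        hsum.summable.of_nonneg_of_le h0 hle
      rw [← ENNReal.ofReal_tsum_of_nonneg h0 hs]
      refine ENNReal.ofReal_le_ofReal ((hs.tsum_le_tsum hle hsum.summable).trans ?_)
      rw [hsum.tsum_eq, entTerm]
      nlinarith [mul_le_mul_of_nonneg_left (hrow1 j) h.le]
  calc ∑' i, ENNReal.ofReal (entTerm X (x i))
      ≤ ∑' i, ∑' j, ENNReal.ofReal (D j i * entTerm X (x i)) := by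
        refine ENNReal.tsum_le_tsum fun i => ?_
        by_cases h : x i = 0
        · simp [h, entTerm]
        · simp_rw [ENNReal.ofReal_mul (hD _ i)]
          rw [ENNReal.tsum_mul_right, hcol i h, one_mul]
    _ = ∑' j, ∑' i, ENNReal.ofReal (D j i * entTerm X (x i)) := ENNReal.tsum_comm
    _ ≤ _ := ENNReal.tsum_le_tsum key

/-- Grouping property (chain rule) of the classical entropy, as an upper bound. -/
theorem clEntropy_sigma_le {β : ι → Type*} {p : (Σ i, β i) → ℝ} {q : ι → ℝ}
    (hp : ∀ a, 0 ≤ p a) (hq : ∀ i, HasSum (fun j => p ⟨i, j⟩) (q i)) (hqs : Summable q) :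
    clEntropy p ≤ ∑' i, clEntropy (fun j => p ⟨i, j⟩) + clEntropy q := by
  have hq0 : ∀ i, 0 ≤ q i := fun i => (hq i).nonneg fun j => hp _
  have hps : HasSum p (∑' i, q i) := by
    have : Summable p := by
      rw [summable_sigma_of_nonneg hp]
      refine ⟨fun i => (hq i).summable, ?_⟩
      simpa only [(hq _).tsum_eq] using hqs
    have h2 := this.hasSum.sigma hq
    rw [h2.tsum_eq]
    exact this.hasSum
  rw [clEntropy_eq hp hps.summable, hps.tsum_eq, ENNReal.tsum_sigma',
    clEntropy_eq hq0 hqs, ← ENNReal.tsum_add]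
  refine ENNReal.tsum_le_tsum fun i => ?_
  rw [clEntropy_eq (fun j => hp _) (hq i).summable, (hq i).tsum_eq]
  have hle : ∀ j, p ⟨i, j⟩ ≤ q i := fun j => (hq i).tsum_eq ▸
    le_tsum_self (fun j => hp ⟨i, j⟩) (hq i).summable j
  have hqX : q i ≤ ∑' i, q i := le_tsum_self hq0 hqs i
  rcases (hq0 i).eq_or_lt with h | h
  · have : ∀ j, p ⟨i, j⟩ = 0 := fun j => le_antisymm (h ▸ hle j) (hp _)
    simp [this, entTerm]
  · set L := Real.log (∑' i, q i) - Real.log (q i) with hL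
    have hL0 : 0 ≤ L := sub_nonneg.2 (Real.log_le_log h hqX)
    have h1 : ∀ j, ENNReal.ofReal (entTerm (∑' i, q i) (p ⟨i, j⟩)) =
        ENNReal.ofReal (entTerm (q i) (p ⟨i, j⟩)) + ENNReal.ofReal (p ⟨i, j⟩ * L) := by
      intro j
      rw [← ENNReal.ofReal_add (entTerm_nonneg (hp _) (hle j)) (mul_nonneg (hp _) hL0)]
      congr 1
      simp only [entTerm, hL]; ring
    simp_rw [h1]
    rw [ENNReal.tsum_add]
    gcongr
    rw [← ENNReal.ofReal_tsum_of_nonneg (fun j => mul_nonneg (hp _) hL0)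
      ((hq i).summable.mul_right _), ((hq i).mul_right L).tsum_eq, entTerm]

theorem clEntropy_bool_le {x : Bool → ℝ} (hx : ∀ i, 0 ≤ x i) {u v : ℝ}
    (huv : Real.exp (-u) + Real.exp (-v) ≤ 1) :
    clEntropy x ≤ ENNReal.ofReal (u * x true + v * x false) := by
  have hs : Summable x := Summable.of_finite
  rw [clEntropy_eq hx hs, tsum_bool,
    ← ENNReal.ofReal_add (entTerm_nonneg (hx _) (le_tsum_self hx hs _))
      (entTerm_nonneg (hx _) (le_tsum_self hx hs _))]
  refine ENNReal.ofReal_le_ofReal ?_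
  have h1 := entTerm_le (hx true) (le_tsum_self hx hs _) (Real.exp_pos (-u))
  have h2 := entTerm_le (hx false) (le_tsum_self hx hs _) (Real.exp_pos (-v))
  have h3 : ∑' i, x i = x false + x true := tsum_bool x
  have h0 : 0 ≤ ∑' i, x i := tsum_nonneg hx
  rw [Real.log_exp] at h1 h2
  nlinarith [mul_le_mul_of_nonneg_right huv h0]

end Classical

section Operators

variable {E : Type*} [NormedAddCommGroup E] [InnerProductSpace ℂ E] [CompleteSpace E]

theorem qf_nonneg {A : E →L[ℂ] E} (hA : A.IsPositive) (x : E) : 0 ≤ qf A x :=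
  hA.re_inner_nonneg_right x

theorem ofReal_qf {A : E →L[ℂ] E} (hA : A.IsPositive) (x : E) :
    ((qf A x : ℝ) : ℂ) = inner ℂ x (A x) := by
  have h := hA.inner_nonneg_right x
  rw [qf]
  exact (Complex.ext rfl (Complex.nonneg_iff.1 h).2)

theorem qf_add (A B : E →L[ℂ] E) (x : E) : qf (A + B) x = qf A x + qf B x := by
  simp [qf]

theorem qf_sub (A B : E →L[ℂ] E) (x : E) : qf (A - B) x = qf A x - qf B x := by
  simp [qf]

theorem qf_smul (c : ℝ) (A : E →L[ℂ] E) (x : E) : qf ((c : ℂ) • A) x = c * qf A x := by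
  simp [qf]

theorem qf_conj (W A : E →L[ℂ] E) (x : E) :
    qf (W ∘L A ∘L ContinuousLinearMap.adjoint W) x =
      qf A (ContinuousLinearMap.adjoint W x) := by
  simp [qf, ContinuousLinearMap.adjoint_inner_left]

theorem abs_qf_le (A : E →L[ℂ] E) (x : E) : |qf A x| ≤ ‖A‖ * ‖x‖ ^ 2 := by
  refine (Complex.abs_re_le_norm _).trans ((norm_inner_le_norm _ _).trans ?_)
  nlinarith [A.le_opNorm x, norm_nonneg x]

/-- The quadratic form of an operator at a vector is a continuous linear function of the
operator. -/
def qfL (x : E) : (E →L[ℂ] E) →L[ℝ] ℝ :=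
  LinearMap.mkContinuous
    { toFun := fun A => qf A x
      map_add' := fun A B => qf_add A B x
      map_smul' := fun c A => by simp [qf, inner_smul_right_eq_smul] }
    (‖x‖ ^ 2) fun A => by
      simpa [mul_comm] using abs_qf_le A x

theorem hasSum_qf {ι : Type*} {X : ι → (E →L[ℂ] E)} {A : E →L[ℂ] E} (h : HasSum X A) (x : E) :
    HasSum (fun i => qf (X i) x) (qf A x) :=
  h.mapL (qfL x)

theorem isPositive_sub {A B : E →L[ℂ] E} (hA : A.IsPositive) (hB : B.IsPositive)
    (h : ∀ x, qf A x ≤ qf B x) : (B - A).IsPositive := by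
  refine ⟨?_, fun x => ?_⟩
  · exact hB.isSymmetric.sub hA.isSymmetric
  · have := h x
    rw [ContinuousLinearMap.reApplyInnerSelf_apply]
    have h2 : RCLike.re (inner ℂ ((B - A) x) x) = qf (B - A) x := by
      rw [qf, inner_re_symm]; rfl
    rw [h2, qf_sub]
    linarith

theorem isPositive_real_smul {A : E →L[ℂ] E} (hA : A.IsPositive) {c : ℝ} (hc : 0 ≤ c) :
    ((c : ℂ) • A).IsPositive := hA.smul_of_nonneg (by exact_mod_cast hc)

theorem exists_sqrt {A : E →L[ℂ] E} (hA : A.IsPositive) :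
    ∃ S : E →L[ℂ] E, ContinuousLinearMap.adjoint S = S ∧ S ∘L S = A := by
  have h0 : 0 ≤ A := (ContinuousLinearMap.nonneg_iff_isPositive A).2 hA
  refine ⟨CFC.sqrt A, ?_, CFC.sqrt_mul_sqrt_self A⟩
  exact (IsSelfAdjoint.of_nonneg (CFC.sqrt_nonneg A))

theorem qf_eq_norm_sq {A S : E →L[ℂ] E} (hS : ContinuousLinearMap.adjoint S = S)
    (hA : S ∘L S = A) (x : E) : qf A x = ‖S x‖ ^ 2 := by
  have : inner ℂ x (A x) = inner ℂ (S x) (S x) := by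
    rw [← ContinuousLinearMap.adjoint_inner_right, hS, ← hA]; rfl
  rw [qf, this]
  exact (norm_sq_eq_re_inner (𝕜 := ℂ) _).symm

theorem norm_inner_sq_le {A : E →L[ℂ] E} (hA : A.IsPositive) (x y : E) :
    ‖(inner ℂ x (A y) : ℂ)‖ ^ 2 ≤ qf A x * qf A y := by
  obtain ⟨S, hS, rfl⟩ := exists_sqrt hA
  rw [qf_eq_norm_sq hS rfl, qf_eq_norm_sq hS rfl, ← mul_pow]
  have : inner ℂ x ((S ∘L S) y) = inner ℂ (S x) (S y) := by
    rw [← ContinuousLinearMap.adjoint_inner_right, hS]; rfl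
  rw [this]
  gcongr
  exact norm_inner_le_norm _ _

theorem hasSum_norm_inner_sq {ι : Type*} (b : HilbertBasis ι ℂ E) (x : E) :
    HasSum (fun i => ‖(inner ℂ (b i) x : ℂ)‖ ^ 2) (‖x‖ ^ 2) := by
  have h := (b.hasSum_inner_mul_inner x x).mapL Complex.reCLM
  have h1 : Complex.reCLM (inner ℂ x x) = ‖x‖ ^ 2 := (norm_sq_eq_re_inner (𝕜 := ℂ) x).symm
  rw [h1] at h
  convert h using 2 with i
  rw [← inner_conj_symm x (b i), mul_comm, RCLike.mul_conj]
  simp [← Complex.ofReal_pow]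

theorem tsum_ofReal_norm_inner_sq {ι : Type*} (b : HilbertBasis ι ℂ E) (x : E) :
    ∑' i, ENNReal.ofReal (‖(inner ℂ (b i) x : ℂ)‖ ^ 2) = ENNReal.ofReal (‖x‖ ^ 2) := by
  have h := hasSum_norm_inner_sq b x
  rw [← ENNReal.ofReal_tsum_of_nonneg (fun i => by positivity) h.summable, h.tsum_eq]

/-- The Hilbert–Schmidt norm of an operator and of its adjoint agree, in any two bases. -/
theorem tsum_norm_sq_adjoint {ι κ : Type*} (b : HilbertBasis ι ℂ E) (c : HilbertBasis κ ℂ E)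
    (Z : E →L[ℂ] E) :
    ∑' i, ENNReal.ofReal (‖Z (b i)‖ ^ 2) =
      ∑' j, ENNReal.ofReal (‖ContinuousLinearMap.adjoint Z (c j)‖ ^ 2) := by
  simp_rw [← tsum_ofReal_norm_inner_sq c (Z _), ← tsum_ofReal_norm_inner_sq b]
  rw [ENNReal.tsum_comm]
  simp_rw [ContinuousLinearMap.adjoint_inner_right, norm_inner_symm]

theorem sum_qf_le_tsum {ι : Type*} (b : HilbertBasis ι ℂ E) {A : E →L[ℂ] E}
    (hA : A.IsPositive) {n : ℕ} {e : Fin n → E} (he : Orthonormal ℂ e) :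
    ∑ k, ENNReal.ofReal (qf A (e k)) ≤ ∑' i, ENNReal.ofReal (qf A (b i)) := by
  obtain ⟨S, hS, rfl⟩ := exists_sqrt hA
  simp_rw [qf_eq_norm_sq hS rfl]
  calc ∑ k, ENNReal.ofReal (‖S (e k)‖ ^ 2)
      = ∑ k, ∑' i, ENNReal.ofReal (‖(inner ℂ (b i) (S (e k)) : ℂ)‖ ^ 2) := by
        simp_rw [tsum_ofReal_norm_inner_sq]
    _ = ∑' i, ∑ k, ENNReal.ofReal (‖(inner ℂ (e k) (S (b i)) : ℂ)‖ ^ 2) := by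
        rw [Summable.tsum_finsetSum fun _ _ => ENNReal.summable]
        refine Finset.sum_congr rfl fun k _ => tsum_congr fun i => ?_
        rw [← ContinuousLinearMap.adjoint_inner_left, hS, norm_inner_symm]
    _ ≤ _ := by
        refine ENNReal.tsum_le_tsum fun i => ?_
        rw [← ENNReal.ofReal_sum_of_nonneg fun _ _ => by positivity]
        exact ENNReal.ofReal_le_ofReal (he.sum_inner_products_le _)

theorem sum_finset_le_traceENN {ι : Type*} {b : ι → E} (hb : Orthonormal ℂ b) (A : E →L[ℂ] E)
    (T : Finset ι) : ∑ i ∈ T, ENNReal.ofReal (qf A (b i)) ≤ traceENN A := by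
  have he : Orthonormal ℂ fun k : Fin T.card => b (T.equivFin.symm k) :=
    hb.comp _ (Subtype.val_injective.comp T.equivFin.symm.injective)
  have h : ∑ i ∈ T, ENNReal.ofReal (qf A (b i)) =
      ∑ k : Fin T.card, ENNReal.ofReal (qf A (b (T.equivFin.symm k))) := by
    rw [← Finset.sum_coe_sort]
    exact (T.equivFin.symm.sum_comp fun i : T => ENNReal.ofReal (qf A (b i))).symm
  rw [h]
  unfold traceENN
  exact le_iSup_of_le T.card (le_iSup₂_of_le _ he le_rfl)

theorem traceENN_eq {ι : Type*} (b : HilbertBasis ι ℂ E) {A : E →L[ℂ] E} (hA : A.IsPositive) :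
    traceENN A = ∑' i, ENNReal.ofReal (qf A (b i)) := by
  refine le_antisymm ?_ ?_
  · exact iSup_le fun n => iSup₂_le fun e he => sum_qf_le_tsum b hA he
  · rw [ENNReal.tsum_eq_iSup_sum]
    exact iSup_le fun T => sum_finset_le_traceENN b.orthonormal A T

theorem traceNorm_le_traceENN {A : E →L[ℂ] E} (hA : A.IsPositive) :
    traceNorm A ≤ traceENN A := by
  refine iSup_le fun n => iSup₂_le fun e f => iSup₂_le fun he hf => ?_
  have h1 : ∀ i, ENNReal.ofReal ‖(inner ℂ (e i) (A (f i)) : ℂ)‖ ≤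
      2⁻¹ * ENNReal.ofReal (qf A (e i)) + 2⁻¹ * ENNReal.ofReal (qf A (f i)) := by
    intro i
    have hc : (2⁻¹ : ℝ≥0∞) = ENNReal.ofReal 2⁻¹ := by
      rw [ENNReal.ofReal_inv_of_pos two_pos]; simp
    have h0 := qf_nonneg hA (e i)
    have h0' := qf_nonneg hA (f i)
    rw [hc, ← ENNReal.ofReal_mul (by norm_num), ← ENNReal.ofReal_mul (by norm_num),
      ← ENNReal.ofReal_add (by positivity) (by positivity)]
    refine ENNReal.ofReal_le_ofReal (abs_le_of_sq_le_sq' ?_ (by positivity)).2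
    nlinarith [norm_inner_sq_le hA (e i) (f i), sq_nonneg (qf A (e i) - qf A (f i))]
  refine (Finset.sum_le_sum fun i _ => h1 i).trans ?_
  rw [Finset.sum_add_distrib, ← Finset.mul_sum, ← Finset.mul_sum]
  have h2 : ∀ g : Fin n → E, Orthonormal ℂ g → ∑ i, ENNReal.ofReal (qf A (g i)) ≤ traceENN A :=
    fun g hg => sum_finset_le_traceENN hg A Finset.univ
  calc _ ≤ 2⁻¹ * traceENN A + 2⁻¹ * traceENN A := by gcongr <;> exact h2 _ ‹_›
    _ = traceENN A := by rw [← add_mul, ENNReal.inv_two_add_inv_two, one_mul]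

theorem sum_norm_inner_le_traceNorm {ι : Type*} {b : ι → E} (hb : Orthonormal ℂ b)
    (A : E →L[ℂ] E) (T : Finset ι) :
    ∑ i ∈ T, ENNReal.ofReal ‖(inner ℂ (b i) (A (b i)) : ℂ)‖ ≤ traceNorm A := by
  have he : Orthonormal ℂ fun k : Fin T.card => b (T.equivFin.symm k) :=
    hb.comp _ (Subtype.val_injective.comp T.equivFin.symm.injective)
  have h : ∑ i ∈ T, ENNReal.ofReal ‖(inner ℂ (b i) (A (b i)) : ℂ)‖ =
      ∑ k : Fin T.card, ENNReal.ofReal ‖(inner ℂ (b (T.equivFin.symm k))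
        (A (b (T.equivFin.symm k))) : ℂ)‖ := by
    rw [← Finset.sum_coe_sort]
    exact (T.equivFin.symm.sum_comp fun i : T =>
      ENNReal.ofReal ‖(inner ℂ (b i) (A (b i)) : ℂ)‖).symm
  rw [h]
  unfold traceNorm
  exact le_iSup_of_le T.card (le_iSup₂_of_le _ _ (le_iSup₂_of_le he he le_rfl))

theorem traceENN_le_traceNorm (A : E →L[ℂ] E) : traceENN A ≤ traceNorm A := by
  refine iSup_le fun n => iSup₂_le fun e he => ?_
  refine le_trans (Finset.sum_le_sum fun i _ => ENNReal.ofReal_le_ofReal ?_)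
    (sum_norm_inner_le_traceNorm he A Finset.univ)
  exact Complex.re_le_norm _

theorem mem_posTC_iff {A : E →L[ℂ] E} : A ∈ posTC E ↔ A.IsPositive ∧ traceENN A ≠ ∞ := by
  refine ⟨fun h => ⟨h.1, ne_top_of_le_ne_top h.2 (traceENN_le_traceNorm A)⟩, fun h => ⟨h.1, ?_⟩⟩
  exact ne_top_of_le_ne_top h.2 (traceNorm_le_traceENN h.1)

theorem ofReal_norm_inner_le_traceNorm (A : E →L[ℂ] E) {x y : E} (hx : ‖x‖ = 1) (hy : ‖y‖ = 1) :
    ENNReal.ofReal ‖(inner ℂ x (A y) : ℂ)‖ ≤ traceNorm A := by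
  have h : ∀ z : E, ‖z‖ = 1 → Orthonormal ℂ fun _ : Fin 1 => z := fun z hz =>
    ⟨fun _ => hz, fun i j h => (h (Subsingleton.elim _ _)).elim⟩
  unfold traceNorm
  refine le_iSup_of_le 1 (le_iSup₂_of_le _ _ (le_iSup₂_of_le (h x hx) (h y hy) ?_))
  simp

theorem norm_inv_norm_smul {x : E} (hx : x ≠ 0) : ‖((‖x‖⁻¹ : ℝ) : ℂ) • x‖ = 1 := by
  rw [norm_smul]; simp [hx]

theorem ofReal_norm_le_traceNorm (A : E →L[ℂ] E) : ENNReal.ofReal ‖A‖ ≤ traceNorm A := by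
  rcases eq_or_ne (traceNorm A) ∞ with h | h
  · simp [h]
  rw [ENNReal.ofReal_le_iff_le_toReal h]
  refine A.opNorm_le_bound ENNReal.toReal_nonneg fun x => ?_
  rcases eq_or_ne (A x) 0 with h0 | h0
  · rw [h0, norm_zero]; positivity
  have hx : x ≠ 0 := fun h => h0 (by simp [h])
  have h1 := ofReal_norm_inner_le_traceNorm A (norm_inv_norm_smul h0) (norm_inv_norm_smul hx)
  rw [ENNReal.ofReal_le_iff_le_toReal h] at h1
  simp only [map_smul, inner_smul_left, inner_smul_right, inner_self_eq_norm_sq_to_K,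
    norm_mul, Complex.conj_ofReal, Complex.norm_real, norm_inv, norm_norm, norm_pow,
    Complex.coe_algebraMap] at h1
  have hx' : 0 < ‖x‖ := norm_pos_iff.2 hx
  have h0' : 0 < ‖A x‖ := norm_pos_iff.2 h0
  have h2 : ‖A x‖⁻¹ * (‖x‖⁻¹ * ‖A x‖ ^ 2) = ‖A x‖ / ‖x‖ := by field_simp
  have h3 : ‖A x‖ / ‖x‖ ≤ (traceNorm A).toReal := by rw [← h2]; linarith
  exact (div_le_iff₀ hx').1 h3

/-- The trace of a positive operator as a real number. -/
def tr (A : E →L[ℂ] E) : ℝ := (traceENN A).toReal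

theorem tr_nonneg (A : E →L[ℂ] E) : 0 ≤ tr A := ENNReal.toReal_nonneg

theorem ofReal_tr {A : E →L[ℂ] E} (hA : A ∈ posTC E) : ENNReal.ofReal (tr A) = traceENN A :=
  ENNReal.ofReal_toReal (mem_posTC_iff.1 hA).2

theorem hasSum_tr {ι : Type*} (b : HilbertBasis ι ℂ E) {A : E →L[ℂ] E} (hA : A ∈ posTC E) :
    HasSum (fun i => qf A (b i)) (tr A) := by
  have h := traceENN_eq b hA.1
  have h1 : ∑' i, ENNReal.ofReal (qf A (b i)) ≠ ∞ := h ▸ (mem_posTC_iff.1 hA).2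
  have h2 : Summable fun i => qf A (b i) := by
    have := ENNReal.summable_toReal h1
    simpa only [ENNReal.toReal_ofReal (qf_nonneg hA.1 _)] using this
  rw [tr, h, ← ENNReal.ofReal_tsum_of_nonneg (fun i => qf_nonneg hA.1 _) h2,
    ENNReal.toReal_ofReal (tsum_nonneg fun i => qf_nonneg hA.1 _)]
  exact h2.hasSum

theorem mem_posTC_of_summable {ι : Type*} (b : HilbertBasis ι ℂ E) {A : E →L[ℂ] E}
    (hA : A.IsPositive) (h : Summable fun i => qf A (b i)) : A ∈ posTC E := by
  rw [mem_posTC_iff, traceENN_eq b hA,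
    ← ENNReal.ofReal_tsum_of_nonneg (fun i => qf_nonneg hA _) h]
  exact ⟨hA, ENNReal.ofReal_ne_top⟩

theorem mem_posTC_of_le {A B : E →L[ℂ] E} (hA : A.IsPositive) (hB : B ∈ posTC E)
    (h : ∀ x, qf A x ≤ qf B x) : A ∈ posTC E := by
  obtain ⟨w, b, -⟩ := exists_hilbertBasis ℂ E
  exact mem_posTC_of_summable b hA
    ((hasSum_tr b hB).summable.of_nonneg_of_le (fun i => qf_nonneg hA _) fun i => h _)

theorem tr_mono {A B : E →L[ℂ] E} (hA : A ∈ posTC E) (hB : B ∈ posTC E)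
    (h : ∀ x, qf A x ≤ qf B x) : tr A ≤ tr B := by
  obtain ⟨w, b, -⟩ := exists_hilbertBasis ℂ E
  exact hasSum_le (fun i => h _) (hasSum_tr b hA) (hasSum_tr b hB)

theorem add_mem_posTC {A B : E →L[ℂ] E} (hA : A ∈ posTC E) (hB : B ∈ posTC E) :
    A + B ∈ posTC E := by
  obtain ⟨w, b, -⟩ := exists_hilbertBasis ℂ E
  refine mem_posTC_of_summable b (hA.1.add hB.1) ?_
  simpa only [qf_add] using (hasSum_tr b hA).summable.add (hasSum_tr b hB).summable

theorem tr_add {A B : E →L[ℂ] E} (hA : A ∈ posTC E) (hB : B ∈ posTC E) :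
    tr (A + B) = tr A + tr B := by
  obtain ⟨w, b, -⟩ := exists_hilbertBasis ℂ E
  refine (hasSum_tr b (add_mem_posTC hA hB)).unique ?_
  simpa only [qf_add] using (hasSum_tr b hA).add (hasSum_tr b hB)

theorem smul_mem_posTC {A : E →L[ℂ] E} (hA : A ∈ posTC E) {c : ℝ} (hc : 0 ≤ c) :
    (c : ℂ) • A ∈ posTC E := by
  obtain ⟨w, b, -⟩ := exists_hilbertBasis ℂ E
  refine mem_posTC_of_summable b (isPositive_real_smul hA.1 hc) ?_
  simpa only [qf_smul] using (hasSum_tr b hA).summable.mul_left c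

theorem tr_smul {A : E →L[ℂ] E} (hA : A ∈ posTC E) {c : ℝ} (hc : 0 ≤ c) :
    tr ((c : ℂ) • A) = c * tr A := by
  obtain ⟨w, b, -⟩ := exists_hilbertBasis ℂ E
  refine (hasSum_tr b (smul_mem_posTC hA hc)).unique ?_
  simpa only [qf_smul] using (hasSum_tr b hA).mul_left c

theorem zero_mem_posTC : (0 : E →L[ℂ] E) ∈ posTC E := by
  obtain ⟨w, b, -⟩ := exists_hilbertBasis ℂ E
  exact mem_posTC_of_summable b (ContinuousLinearMap.isPositive_zero) (by simp [qf, summable_zero])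

theorem tr_zero : tr (0 : E →L[ℂ] E) = 0 := by
  obtain ⟨w, b, -⟩ := exists_hilbertBasis ℂ E
  exact (hasSum_tr b zero_mem_posTC).unique (by simp [qf, hasSum_zero])

theorem qf_le_tr {A : E →L[ℂ] E} (hA : A ∈ posTC E) (x : E) : qf A x ≤ tr A * ‖x‖ ^ 2 := by
  rcases eq_or_ne x 0 with rfl | hx
  · simp [qf]
  have hx' : ‖x‖ ≠ 0 := norm_ne_zero_iff.2 hx
  set y : E := ((‖x‖⁻¹ : ℝ) : ℂ) • x with hy
  have hon : Orthonormal ℂ fun _ : Unit => y := by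
    refine ⟨fun _ => ?_, fun i j h => (h (Subsingleton.elim _ _)).elim⟩
    rw [hy, norm_smul]; simp [hx']
  have h := sum_finset_le_traceENN hon A Finset.univ
  rw [← ofReal_tr hA] at h
  simp only [Finset.univ_unique, Finset.sum_const, Finset.card_singleton, one_smul] at h
  rw [ENNReal.ofReal_le_ofReal_iff (tr_nonneg A)] at h
  have h2 : qf A x = qf A y * ‖x‖ ^ 2 := by
    have : x = ((‖x‖ : ℝ) : ℂ) • y := by
      rw [hy, smul_smul, ← Complex.ofReal_mul, mul_inv_cancel₀ hx']; simp
    conv_lhs => rw [this]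
    simp only [qf, map_smul, inner_smul_left, inner_smul_right, Complex.conj_ofReal,
      ← mul_assoc, ← Complex.ofReal_mul]
    rw [Complex.re_ofReal_mul]
    ring
  rw [h2]
  gcongr

theorem conj_mem_posTC {A : E →L[ℂ] E} (hA : A ∈ posTC E) (W : E →L[ℂ] E) :
    W ∘L A ∘L ContinuousLinearMap.adjoint W ∈ posTC E := by
  have hpos := hA.1.conj_adjoint W
  refine mem_posTC_iff.2 ⟨hpos, ?_⟩
  obtain ⟨w, b, -⟩ := exists_hilbertBasis ℂ E
  obtain ⟨S, hS, hSA⟩ := exists_sqrt hA.1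
  have h1 := traceENN_eq b hA.1
  rw [traceENN_eq b hpos]
  simp_rw [qf_conj, qf_eq_norm_sq hS hSA] at h1 ⊢
  have h2 := tsum_norm_sq_adjoint b b (S ∘L ContinuousLinearMap.adjoint W)
  simp only [ContinuousLinearMap.adjoint_comp, ContinuousLinearMap.adjoint_adjoint, hS,
    ContinuousLinearMap.comp_apply] at h2
  rw [h2]
  have h3 : ∑' i, ENNReal.ofReal (‖W (S (b i))‖ ^ 2) ≤ ENNReal.ofReal (‖W‖ ^ 2) * traceENN A := by
    rw [h1, ← ENNReal.tsum_mul_left]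
    refine ENNReal.tsum_le_tsum fun i => ?_
    rw [← ENNReal.ofReal_mul (by positivity), ← mul_pow]
    gcongr
    exact W.le_opNorm _
  exact ne_top_of_le_ne_top (ENNReal.mul_ne_top ENNReal.ofReal_ne_top (mem_posTC_iff.1 hA).2) h3

end Operators

section Spectral

universe u

variable {E : Type u} [NormedAddCommGroup E] [InnerProductSpace ℂ E] [CompleteSpace E]

theorem rankOne_apply (x y : E) : rankOne x y = (inner ℂ x y : ℂ) • x := rfl

theorem qf_rankOne (x y : E) : qf (rankOne x) y = ‖(inner ℂ x y : ℂ)‖ ^ 2 := by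
  rw [qf, rankOne_apply, inner_smul_right, ← inner_conj_symm y x, RCLike.mul_conj]
  simp [← Complex.ofReal_pow]

theorem adjoint_rankOne (x : E) : ContinuousLinearMap.adjoint (rankOne x) = rankOne x := by
  refine ((ContinuousLinearMap.eq_adjoint_iff _ _).2 fun y z => ?_).symm
  simp [rankOne_apply, inner_smul_left, inner_smul_right, mul_comm]

theorem rankOne_isPositive (x : E) : (rankOne x).IsPositive := by
  refine (ContinuousLinearMap.isPositive_iff_complex _).2 fun y => ?_
  have h : inner ℂ (rankOne x y) y = ((‖(inner ℂ x y : ℂ)‖ ^ 2 : ℝ) : ℂ) := by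
    rw [rankOne_apply, inner_smul_left, mul_comm, RCLike.mul_conj]; simp
  rw [h]
  exact ⟨by exact congrArg _ (Complex.ofReal_re _), (sq_nonneg _).trans_eq (Complex.ofReal_re _).symm⟩

theorem rankOne_mem_posTC (x : E) : rankOne x ∈ posTC E := by
  obtain ⟨w, b, -⟩ := exists_hilbertBasis ℂ E
  refine mem_posTC_of_summable b (rankOne_isPositive x) ?_
  simpa only [qf_rankOne, norm_inner_symm x] using (hasSum_norm_inner_sq b x).summable

theorem tr_rankOne (x : E) : tr (rankOne x) = ‖x‖ ^ 2 := by
  obtain ⟨w, b, -⟩ := exists_hilbertBasis ℂ E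
  refine (hasSum_tr b (rankOne_mem_posTC x)).unique ?_
  simpa only [qf_rankOne, norm_inner_symm x] using hasSum_norm_inner_sq b x

/-- The operator with eigenvalues `c i` on the vectors `b i`, `i ∈ T`. -/
def diagOp {ι : Type*} (b : ι → E) (T : Finset ι) (c : ι → ℝ) : E →L[ℂ] E :=
  ∑ i ∈ T, (c i : ℂ) • rankOne (b i)

theorem diagOp_apply {ι : Type*} (b : ι → E) (T : Finset ι) (c : ι → ℝ) (x : E) :
    diagOp b T c x = ∑ i ∈ T, ((c i : ℂ) * (inner ℂ (b i) x : ℂ)) • b i := by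
  rw [diagOp, sum_apply]
  refine Finset.sum_congr rfl fun i _ => ?_
  rw [smul_apply, rankOne_apply, smul_smul]

theorem qf_diagOp {ι : Type*} (b : ι → E) (T : Finset ι) (c : ι → ℝ) (x : E) :
    qf (diagOp b T c) x = ∑ i ∈ T, c i * ‖(inner ℂ (b i) x : ℂ)‖ ^ 2 := by
  have h := map_sum (qfL x) (fun i => (c i : ℂ) • rankOne (b i)) T
  refine h.trans (Finset.sum_congr rfl fun i _ => ?_)
  exact (qf_smul _ _ _).trans (by rw [qf_rankOne])

theorem adjoint_diagOp {ι : Type*} (b : ι → E) (T : Finset ι) (c : ι → ℝ) :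
    ContinuousLinearMap.adjoint (diagOp b T c) = diagOp b T c := by
  rw [diagOp, map_sum]
  refine Finset.sum_congr rfl fun i _ => ?_
  rw [LinearIsometryEquiv.map_smulₛₗ, adjoint_rankOne]; simp

theorem inner_diagOp {ι : Type*} {b : ι → E} (hb : Orthonormal ℂ b) (T : Finset ι) (c : ι → ℝ)
    (x : E) (j : ι) :
    (inner ℂ (b j) (diagOp b T c x) : ℂ) = if j ∈ T then (c j : ℂ) * inner ℂ (b j) x else 0 := by
  rw [diagOp_apply, inner_sum]
  simp_rw [inner_smul_right, orthonormal_iff_ite.1 hb]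
  simp

theorem diagOp_apply_basis {ι : Type*} {b : ι → E} (hb : Orthonormal ℂ b) (T : Finset ι)
    (c : ι → ℝ) (j : ι) :
    diagOp b T c (b j) = if j ∈ T then (c j : ℂ) • b j else 0 := by
  rw [diagOp_apply]
  simp_rw [orthonormal_iff_ite.1 hb]
  simp

theorem rank_diagOp {ι : Type*} (b : ι → E) (T : Finset ι) (c : ι → ℝ) :
    rankLE (diagOp b T c) T.card := by
  have h : LinearMap.range (diagOp b T c : E →ₗ[ℂ] E) ≤ Submodule.span ℂ (T.image b : Set E) := by
    rintro _ ⟨x, rfl⟩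
    change diagOp b T c x ∈ _
    rw [diagOp_apply]
    refine Submodule.sum_mem _ fun i hi => Submodule.smul_mem _ _ (Submodule.subset_span ?_)
    simpa using ⟨i, hi, rfl⟩
  refine (Submodule.rank_mono h).trans ((rank_span_finset_le _).trans ?_)
  exact_mod_cast Finset.card_image_le

theorem rankLE_conj {A : E →L[ℂ] E} {k : ℕ} (h : rankLE A k) (W V : E →L[ℂ] E) :
    rankLE (W ∘L A ∘L V) k := by
  have h1 : LinearMap.rank ((W : E →ₗ[ℂ] E) ∘ₗ ((A : E →ₗ[ℂ] E) ∘ₗ (V : E →ₗ[ℂ] E))) ≤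
      LinearMap.rank (A : E →ₗ[ℂ] E) :=
    (LinearMap.rank_comp_le_right _ _).trans (LinearMap.rank_comp_le_left _ _)
  exact h1.trans h

theorem rankLE_mono {A : E →L[ℂ] E} {k m : ℕ} (h : rankLE A k) (hkm : k ≤ m) : rankLE A m :=
  le_trans h (by exact_mod_cast hkm)

theorem rankLE_smul {A : E →L[ℂ] E} {k : ℕ} (h : rankLE A k) (c : ℂ) : rankLE (c • A) k := by
  have := rankLE_conj h (c • ContinuousLinearMap.id ℂ E) (ContinuousLinearMap.id ℂ E)
  simpa using this

theorem rankLE_rankOne (x : E) : rankLE (rankOne x) 1 := by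
  have h := rank_diagOp (fun _ : Unit => x) Finset.univ 1
  simpa [diagOp] using h

theorem rankLE_zero (k : ℕ) : rankLE (0 : E →L[ℂ] E) k := by
  simp [rankLE]

theorem isCompactOperator_of_rankLE {A : E →L[ℂ] E} {k : ℕ} (h : rankLE A k) :
    IsCompactOperator A := by
  have hfin : FiniteDimensional ℂ (LinearMap.range (A : E →ₗ[ℂ] E)) :=
    Module.rank_lt_aleph0_iff.1 (lt_of_le_of_lt h (Cardinal.natCast_lt_aleph0))
  have : LocallyCompactSpace (LinearMap.range (A : E →ₗ[ℂ] E)) :=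
    have := FiniteDimensional.proper ℂ (LinearMap.range (A : E →ₗ[ℂ] E))
    inferInstance
  have h1 : IsCompactOperator (A.codRestrict (LinearMap.range (A : E →ₗ[ℂ] E))
      fun x => ⟨x, rfl⟩ : E →L[ℂ] LinearMap.range (A : E →ₗ[ℂ] E)) := isCompactOperator_of_locallyCompactSpace_dom _
  exact h1.clm_comp (LinearMap.range (A : E →ₗ[ℂ] E)).subtypeL

theorem isCompactOperator_of_mem_posTC {A : E →L[ℂ] E} (hA : A ∈ posTC E) :
    IsCompactOperator A := by
  obtain ⟨w, b, -⟩ := exists_hilbertBasis ℂ E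
  obtain ⟨S, hS, hSA⟩ := exists_sqrt hA.1
  have hsum : Summable fun i => ‖S (b i)‖ ^ 2 := by
    simpa only [qf_eq_norm_sq hS hSA] using (hasSum_tr b hA).summable
  have hlim : Tendsto (fun T : Finset w => diagOp b T 1 ∘L S) atTop (𝓝 S) := by
    rw [tendsto_iff_norm_sub_tendsto_zero]
    have h0 := tendsto_tsum_compl_atTop_zero fun i => ‖S (b i)‖ ^ 2
    have h1 : Tendsto (fun T : Finset w => √(∑' i : {i // i ∉ T}, ‖S (b i)‖ ^ 2)) atTop (𝓝 0) := by
      simpa [Function.comp_def] using (Real.continuous_sqrt.tendsto 0).comp h0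
    refine squeeze_zero (fun _ => norm_nonneg _) (fun T => ?_) h1
    refine ContinuousLinearMap.opNorm_le_bound _ (Real.sqrt_nonneg _) fun y => ?_
    refine abs_le_of_sq_le_sq' ?_ (by positivity) |>.2
    have hT : Summable fun i : {i // i ∉ T} => ‖S (b i)‖ ^ 2 := hsum.subtype _
    rw [mul_pow, Real.sq_sqrt (tsum_nonneg fun _ => by positivity), ← tsum_mul_right,
      ← (hasSum_norm_inner_sq b _).tsum_eq]
    have h2 : ∀ i, (inner ℂ (b i) ((diagOp b T 1 ∘L S - S) y) : ℂ) =
        if i ∈ T then 0 else - inner ℂ (S (b i)) y := by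
      intro i
      have : (inner ℂ (b i) (S y) : ℂ) = inner ℂ (S (b i)) y := by
        rw [← ContinuousLinearMap.adjoint_inner_left, hS]
      rw [sub_apply, inner_sub_right, ContinuousLinearMap.comp_apply,
        inner_diagOp b.orthonormal, this]
      split_ifs <;> simp
    have h3 : ∑' i, ‖(inner ℂ (b i) ((diagOp b T 1 ∘L S - S) y) : ℂ)‖ ^ 2 =
        ∑' i : {i // i ∉ T}, ‖(inner ℂ (b i) ((diagOp b T 1 ∘L S - S) y) : ℂ)‖ ^ 2 := by
      refine (tsum_subtype_eq_of_support_subset (s := {i | i ∉ T}) fun i hi => ?_).symm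
      intro hiT
      exact hi (by beta_reduce; rw [h2, if_pos hiT]; simp)
    rw [h3]
    refine Summable.tsum_le_tsum (fun i => ?_)
      ((hasSum_norm_inner_sq b _).summable.subtype _) (hT.mul_right _)
    rw [h2, if_neg i.2, norm_neg, ← mul_pow]
    gcongr
    exact norm_inner_le_norm _ _
  have hSc : IsCompactOperator S :=
    isCompactOperator_of_tendsto hlim
      (Eventually.of_forall fun T => isCompactOperator_of_rankLE (k := T.card) <| by
        simpa using rankLE_conj (rank_diagOp b T 1) (ContinuousLinearMap.id ℂ E) S)
  rw [← hSA]
  exact hSc.comp_clm S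

theorem exists_eigenbasis_of_compact {A : E →L[ℂ] E} (hA : A.IsPositive)
    (hc : IsCompactOperator A) :
    ∃ (ι : Type u) (b : HilbertBasis ι ℂ E), ∀ i, A (b i) = (qf A (b i) : ℂ) • b i := by
  have hsymm : (A : E →ₗ[ℂ] E).IsSymmetric := hA.isSymmetric
  let V : ℂ → Submodule ℂ E := fun μ => Module.End.eigenspace (A : E →ₗ[ℂ] E) μ
  have hcl : ∀ μ, IsClosed (V μ : Set E) := fun μ => by
    have : (V μ : Set E) = {x | A x = μ • x} := by
      ext x; exact Module.End.mem_eigenspace_iff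
    rw [this]
    exact isClosed_eq A.continuous (continuous_const_smul μ)
  have hcomp : ∀ μ, CompleteSpace (V μ) := fun μ => (hcl μ).completeSpace_coe
  choose w c hc' using fun μ => exists_hilbertBasis ℂ (V μ)
  have hon : Orthonormal ℂ fun a : Σ μ, w μ => (V a.1).subtypeₗᵢ (c a.1 a.2) :=
    hsymm.orthogonalFamily_eigenspaces.orthonormal_sigma_orthonormal
      fun μ => (c μ).orthonormal
  have hbot : (Submodule.span ℂ (Set.range fun a : Σ μ, w μ =>
      (V a.1).subtypeₗᵢ (c a.1 a.2)))ᗮ = ⊥ := by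
    rw [← ContinuousLinearMap.orthogonalComplement_iSup_eigenspaces_eq_bot hc hsymm]
    refine le_antisymm ?_ (Submodule.orthogonal_le ?_)
    · intro x hx
      rw [← Submodule.iInf_orthogonal, Submodule.mem_iInf]
      intro μ
      rw [Submodule.mem_orthogonal']
      intro v hv
      have h1 : ∀ i, (inner ℂ x (c μ i : E) : ℂ) = 0 := fun i =>
        (Submodule.mem_orthogonal' _ _).1 hx _ (Submodule.subset_span ⟨⟨μ, i⟩, rfl⟩)
      have h2 := ((c μ).hasSum_repr ⟨v, hv⟩).mapL ((innerSL ℂ x) ∘L (V μ).subtypeL)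
      have h3 : (fun i => ((innerSL ℂ x) ∘L (V μ).subtypeL) ((c μ).repr ⟨v, hv⟩ i • c μ i)) =
          fun _ => 0 := by
        funext i
        simp [h1]
      rw [h3] at h2
      exact h2.unique hasSum_zero
    · rw [Submodule.span_le]
      rintro _ ⟨a, rfl⟩
      exact Submodule.mem_iSup_of_mem a.1 (c a.1 a.2).2
  refine ⟨_, HilbertBasis.mkOfOrthogonalEqBot hon hbot, fun i => ?_⟩
  rw [HilbertBasis.coe_mkOfOrthogonalEqBot]
  have h1 : A (c i.1 i.2 : E) = i.1 • (c i.1 i.2 : E) :=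
    Module.End.mem_eigenspace_iff.1 (c i.1 i.2).2
  have h2 : ‖(c i.1 i.2 : E)‖ = 1 := (c i.1).orthonormal.1 i.2
  rw [ofReal_qf hA]
  simp only [Submodule.coe_subtypeₗᵢ, Submodule.coe_subtype] 
  rw [h1, inner_smul_right, inner_self_eq_norm_sq_to_K, h2]
  simp

theorem exists_eigenbasis {A : E →L[ℂ] E} (hA : A ∈ posTC E) :
    ∃ (ι : Type u) (b : HilbertBasis ι ℂ E), ∀ i, A (b i) = (qf A (b i) : ℂ) • b i :=
  exists_eigenbasis_of_compact hA.1 (isCompactOperator_of_mem_posTC hA)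

theorem hasSum_qf_eigenbasis {ι : Type*} {A : E →L[ℂ] E} {b : HilbertBasis ι ℂ E}
    (hb : ∀ i, A (b i) = (qf A (b i) : ℂ) • b i) (hA : A.IsPositive) (x : E) :
    HasSum (fun i => qf A (b i) * ‖(inner ℂ (b i) x : ℂ)‖ ^ 2) (qf A x) := by
  have h := (b.hasSum_inner_mul_inner x (A x)).mapL Complex.reCLM
  have he : (fun i => qf A (b i) * ‖(inner ℂ (b i) x : ℂ)‖ ^ 2) =
      fun i => Complex.reCLM (inner ℂ x (b i) * inner ℂ (b i) (A x)) := ?_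
  · rw [he]; exact h
  funext i
  have h1 : (inner ℂ (b i) (A x) : ℂ) = qf A (b i) * inner ℂ (b i) x := by
    have h2 : (inner ℂ (b i) (A x) : ℂ) = inner ℂ (A (b i)) x := (hA.isSymmetric (b i) x).symm
    rw [h2, hb i, inner_smul_left, Complex.conj_ofReal]
  rw [h1, ← inner_conj_symm x (b i), mul_left_comm, mul_comm (starRingEnd ℂ _), RCLike.mul_conj]
  simp [← Complex.ofReal_pow]

/-- A positive operator of rank at most `k` has at most `k` nonzero eigenvalues. -/
theorem exists_card_le_of_rankLE {ι : Type*} {A : E →L[ℂ] E} {b : HilbertBasis ι ℂ E}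
    (hb : ∀ i, A (b i) = (qf A (b i) : ℂ) • b i) {k : ℕ} (hk : rankLE A k) :
    ∃ T : Finset ι, T.card ≤ k ∧ ∀ i ∉ T, qf A (b i) = 0 := by
  have key : ∀ T : Finset ι, (∀ i ∈ T, qf A (b i) ≠ 0) → T.card ≤ k := by
    intro T hT
    let v : T → LinearMap.range (A : E →ₗ[ℂ] E) := fun i =>
      ⟨b i, ⟨((qf A (b i) : ℂ))⁻¹ • b i, by
        have h0 : (qf A (b i) : ℂ) ≠ 0 := by exact_mod_cast hT i i.2
        change A _ = _
        rw [map_smul, hb i, smul_smul, inv_mul_cancel₀ h0, one_smul]⟩⟩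
    have hv : LinearIndependent ℂ v := by
      refine LinearIndependent.of_comp (LinearMap.range (A : E →ₗ[ℂ] E)).subtype ?_
      exact b.orthonormal.linearIndependent.comp _ Subtype.val_injective
    have := hv.cardinal_lift_le_rank
    have h2 := le_trans this (Cardinal.lift_le.2 hk)
    simpa using h2
  have hfin : {i | qf A (b i) ≠ 0}.Finite := by
    by_contra hinf
    obtain ⟨T, hT, hcard⟩ := Set.Infinite.exists_subset_card_eq hinf (k + 1)
    have := key T fun i hi => hT hi
    omega
  refine ⟨hfin.toFinset, key _ fun i hi => by simpa using hi, fun i hi => ?_⟩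
  simpa using hi

theorem mem_posTC_of_rankLE {A : E →L[ℂ] E} (hA : A.IsPositive) {k : ℕ} (hk : rankLE A k) :
    A ∈ posTC E := by
  obtain ⟨ι, b, hb⟩ := exists_eigenbasis_of_compact hA (isCompactOperator_of_rankLE hk)
  obtain ⟨T, -, hT⟩ := exists_card_le_of_rankLE hb hk
  exact mem_posTC_of_summable b hA (summable_of_ne_finset_zero (s := T) hT)

end Spectral

section Entropy

universe u

variable {E : Type u} [NormedAddCommGroup E] [InnerProductSpace ℂ E] [CompleteSpace E]

theorem hasSum_of_tsum_ofReal {ι : Type*} {f : ι → ℝ} {X : ℝ} (hf : ∀ i, 0 ≤ f i) (hX : 0 ≤ X)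
    (h : ∑' i, ENNReal.ofReal (f i) = ENNReal.ofReal X) : HasSum f X := by
  have h1 : ∑' i, ENNReal.ofReal (f i) ≠ ∞ := h ▸ ENNReal.ofReal_ne_top
  have h2 : Summable f := by
    simpa only [ENNReal.toReal_ofReal (hf _)] using ENNReal.summable_toReal h1
  rw [← ENNReal.ofReal_tsum_of_nonneg hf h2,
    ENNReal.ofReal_eq_ofReal_iff (tsum_nonneg hf) hX] at h
  exact h ▸ h2.hasSum

theorem tsum_ofReal_of_hasSum {ι : Type*} {f : ι → ℝ} {X : ℝ} (hf : ∀ i, 0 ≤ f i)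
    (h : HasSum f X) : ∑' i, ENNReal.ofReal (f i) = ENNReal.ofReal X := by
  rw [← ENNReal.ofReal_tsum_of_nonneg hf h.summable, h.tsum_eq]

theorem qEntropy_le_clEntropy {ι : Type*} (b : HilbertBasis ι ℂ E) (A : E →L[ℂ] E) :
    qEntropy A ≤ clEntropy fun i => qf A (b i) := by
  have hinj : Function.Injective b := b.orthonormal.linearIndependent.injective
  have hs : IsONB (Set.range b) := by
    refine ⟨b.orthonormal.toSubtypeRange, ?_⟩
    rw [Submodule.dense_iff_topologicalClosure_eq_top]
    exact b.dense_span
  refine (iInf₂_le _ hs).trans_eq ?_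
  rw [← clEntropy_congr_equiv (Equiv.ofInjective b hinj)]
  rfl

theorem IsONB.exists_hilbertBasis {s : Set E} (hs : IsONB s) :
    ∃ b : HilbertBasis s ℂ E, ⇑b = ((↑) : s → E) := by
  have h : ⊤ ≤ (Submodule.span ℂ (Set.range ((↑) : s → E))).topologicalClosure := by
    rw [Subtype.range_coe, (Submodule.dense_iff_topologicalClosure_eq_top).1 hs.2]
  exact ⟨HilbertBasis.mk hs.1 h, HilbertBasis.coe_mk hs.1 h⟩

theorem qEntropy_mono {A B : E →L[ℂ] E} (hA : A.IsPositive) (hB : B ∈ posTC E)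
    (h : ∀ x, qf A x ≤ qf B x) : qEntropy A ≤ qEntropy B := by
  refine le_iInf₂ fun s hs => (iInf₂_le s hs).trans ?_
  obtain ⟨b, hb⟩ := hs.exists_hilbertBasis
  refine clEntropy_mono (fun i => qf_nonneg hA _) (fun i => h _) ?_
  simpa only [hb] using (hasSum_tr b hB).summable

/-- The entropy of a positive trace class operator is the entropy of its spectrum. -/
theorem qEntropy_eq {ι : Type*} {A : E →L[ℂ] E} (hA : A ∈ posTC E) {b : HilbertBasis ι ℂ E}
    (hb : ∀ i, A (b i) = (qf A (b i) : ℂ) • b i) :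
    qEntropy A = clEntropy fun i => qf A (b i) := by
  refine le_antisymm (qEntropy_le_clEntropy b A) (le_iInf₂ fun s hs => ?_)
  obtain ⟨f, hf⟩ := hs.exists_hilbertBasis
  have hfs : (fun v : s => qf A v) = fun j => qf A (f j) := by rw [hf]
  rw [hfs]
  have h1 : ∀ j, HasSum (fun i => ‖(inner ℂ (b i) (f j) : ℂ)‖ ^ 2) 1 := fun j => by
    simpa [f.orthonormal.1 j] using hasSum_norm_inner_sq b (f j)
  refine clEntropy_le_of_mixing (D := fun j i => ‖(inner ℂ (b i) (f j) : ℂ)‖ ^ 2)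
    (fun i => qf_nonneg hA.1 _) (hasSum_tr b hA) (hasSum_tr f hA) (fun _ _ => by positivity)
    (fun j => (h1 j).summable) (fun j => (h1 j).tsum_eq.le) (fun i _ => ?_) fun j => ?_
  · simp_rw [norm_inner_symm (b i)]
    rw [tsum_ofReal_norm_inner_sq, b.orthonormal.1 i]; simp
  · simpa only [mul_comm] using hasSum_qf_eigenbasis hb hA.1 (f j)

theorem qEntropy_smul {A : E →L[ℂ] E} (hA : A ∈ posTC E) {c : ℝ} (hc : 0 ≤ c) :
    qEntropy ((c : ℂ) • A) = ENNReal.ofReal c * qEntropy A := by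
  obtain ⟨ι, b, hb⟩ := exists_eigenbasis hA
  have hb' : ∀ i, ((c : ℂ) • A) (b i) = (qf ((c : ℂ) • A) (b i) : ℂ) • b i := fun i => by
    rw [smul_apply, qf_smul, Complex.ofReal_mul, ← smul_smul, ← hb i]
  rw [qEntropy_eq hA hb, qEntropy_eq (smul_mem_posTC hA hc) hb']
  simp_rw [qf_smul]
  exact clEntropy_smul hc

theorem qEntropy_le_rank {A : E →L[ℂ] E} (hA : A.IsPositive) {k : ℕ} (hk : rankLE A k) :
    qEntropy A ≤ k * ENNReal.ofReal (tr A) := by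
  have hA' := mem_posTC_of_rankLE hA hk
  obtain ⟨ι, b, hb⟩ := exists_eigenbasis hA'
  obtain ⟨T, hTk, hT⟩ := exists_card_le_of_rankLE hb hk
  rw [qEntropy_eq hA' hb, ← (hasSum_tr b hA').tsum_eq]
  refine (clEntropy_le_card (fun i => qf_nonneg hA _) T hT).trans ?_
  gcongr

theorem qEntropy_eq_zero {A : E →L[ℂ] E} (hA : A.IsPositive) (h1 : rankLE A 1) :
    qEntropy A = 0 := by
  have hA' := mem_posTC_of_rankLE hA h1
  obtain ⟨ι, b, hb⟩ := exists_eigenbasis hA'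
  obtain ⟨T, hTk, hT⟩ := exists_card_le_of_rankLE hb h1
  rw [qEntropy_eq hA' hb]
  refine clEntropy_eq_zero_of_subsingleton (fun i => qf_nonneg hA _) fun i j hi hj => ?_
  exact Finset.card_le_one.1 hTk i (not_imp_comm.1 (hT i) hi) j (not_imp_comm.1 (hT j) hj)

theorem hasSum_norm_sq_ensemble {κ : Type*} {A : E →L[ℂ] E} (hA : A ∈ posTC E) {y : κ → E}
    (hy : ∀ x, HasSum (fun j => ‖(inner ℂ (y j) x : ℂ)‖ ^ 2) (qf A x)) :
    HasSum (fun j => ‖y j‖ ^ 2) (tr A) := by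
  obtain ⟨w, b, -⟩ := exists_hilbertBasis ℂ E
  refine hasSum_of_tsum_ofReal (fun _ => by positivity) (tr_nonneg A) ?_
  simp_rw [← tsum_ofReal_norm_inner_sq b (y _)]
  rw [ENNReal.tsum_comm, ofReal_tr hA, traceENN_eq b hA.1]
  refine tsum_congr fun i => ?_
  simp_rw [norm_inner_symm (b i)]
  exact tsum_ofReal_of_hasSum (fun _ => by positivity) (hy (b i))

/-- The entropy is dominated by the entropy of the weights of any decomposition into
rank-one operators. -/
theorem qEntropy_le_ensemble {κ : Type*} {A : E →L[ℂ] E} (hA : A ∈ posTC E) {y : κ → E}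
    (hy : ∀ x, HasSum (fun j => ‖(inner ℂ (y j) x : ℂ)‖ ^ 2) (qf A x)) :
    qEntropy A ≤ clEntropy fun j => ‖y j‖ ^ 2 := by
  obtain ⟨ι, b, hb⟩ := exists_eigenbasis hA
  refine (qEntropy_le_clEntropy b A).trans ?_
  have hl : ∀ i, 0 ≤ qf A (b i) := fun i => qf_nonneg hA.1 _
  have hpart : ∀ j (T : Finset ι), ∑ i ∈ T, ‖(inner ℂ (b i) (y j) : ℂ)‖ ^ 2 / qf A (b i) ≤ 1 := by
    intro j T
    set N := ∑ i ∈ T, ‖(inner ℂ (b i) (y j) : ℂ)‖ ^ 2 / qf A (b i) with hN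
    have hN0 : 0 ≤ N := Finset.sum_nonneg fun i _ => div_nonneg (by positivity) (hl i)
    let w := diagOp b T (fun i => (qf A (b i))⁻¹) (y j)
    have h1 : qf (diagOp b T (fun i => (qf A (b i))⁻¹)) (y j) = N := by
      rw [qf_diagOp]
      exact Finset.sum_congr rfl fun i _ => by rw [div_eq_inv_mul]
    have h2 : N ≤ ‖(inner ℂ (y j) w : ℂ)‖ := by
      rw [← h1]; exact Complex.re_le_norm _
    have h3 : ‖(inner ℂ (y j) w : ℂ)‖ ^ 2 ≤ qf A w := le_hasSum (hy w) j fun _ _ => by positivity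
    have h4 : qf A w = N := by
      refine (hasSum_qf_eigenbasis hb hA.1 w).unique ?_
      rw [hN]
      have : ∀ i, qf A (b i) * ‖(inner ℂ (b i) w : ℂ)‖ ^ 2 =
          if i ∈ T then ‖(inner ℂ (b i) (y j) : ℂ)‖ ^ 2 / qf A (b i) else 0 := by
        intro i
        rw [inner_diagOp b.orthonormal]
        split_ifs with hi
        · rw [norm_mul, Complex.norm_real, norm_inv, Real.norm_of_nonneg (hl i)]
          rcases eq_or_ne (qf A (b i)) 0 with h0 | h0
          · simp [h0]
          · field_simp
        · simp
      simp_rw [this]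
      rw [Finset.sum_congr rfl fun i hi => (if_pos hi).symm]
      exact hasSum_sum_of_ne_finset_zero fun i hi => if_neg hi
    by_contra hlt
    push Not at hlt
    nlinarith
  have hrow : ∀ j, Summable fun i => ‖(inner ℂ (b i) (y j) : ℂ)‖ ^ 2 / qf A (b i) := fun j =>
    summable_of_sum_le (fun i => div_nonneg (by positivity) (hl i)) (hpart j)
  refine clEntropy_le_of_mixing (D := fun j i => ‖(inner ℂ (b i) (y j) : ℂ)‖ ^ 2 / qf A (b i))
    hl (hasSum_tr b hA) (hasSum_norm_sq_ensemble hA hy)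
    (fun j i => div_nonneg (by positivity) (hl i)) hrow
    (fun j => (hrow j).tsum_le_of_sum_le (hpart j)) (fun i hi => ?_) fun j => ?_
  · have h := (hy (b i)).div_const (qf A (b i))
    rw [div_self hi] at h
    simp_rw [norm_inner_symm (b i)]
    simpa using tsum_ofReal_of_hasSum (fun j => div_nonneg (by positivity) (hl i)) h
  · convert hasSum_norm_inner_sq b (y j) using 2 with i
    refine div_mul_cancel_of_imp fun h0 => ?_
    have := le_hasSum (hy (b i)) j fun _ _ => by positivity
    rw [h0, norm_inner_symm] at this
    exact le_antisymm this (by positivity)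

theorem norm_sqrt_smul_sq {l : ℝ} (hl : 0 ≤ l) (x : E) : ‖((√l : ℝ) : ℂ) • x‖ ^ 2 = l * ‖x‖ ^ 2 := by
  rw [norm_smul, mul_pow, Complex.norm_real, Real.norm_of_nonneg (Real.sqrt_nonneg _),
    Real.sq_sqrt hl]

theorem norm_inner_sqrt_smul_sq {l : ℝ} (hl : 0 ≤ l) (x y : E) :
    ‖(inner ℂ (((√l : ℝ) : ℂ) • x) y : ℂ)‖ ^ 2 = l * ‖(inner ℂ x y : ℂ)‖ ^ 2 := by
  rw [inner_smul_left, norm_mul, mul_pow, Complex.conj_ofReal, Complex.norm_real,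
    Real.norm_of_nonneg (Real.sqrt_nonneg _), Real.sq_sqrt hl]

theorem qEntropy_conj_le {ι : Type*} {A : E →L[ℂ] E} (hA : A ∈ posTC E) {b : HilbertBasis ι ℂ E}
    (hb : ∀ i, A (b i) = (qf A (b i) : ℂ) • b i) (W : E →L[ℂ] E) :
    qEntropy (W ∘L A ∘L ContinuousLinearMap.adjoint W) ≤
      clEntropy fun i => qf A (b i) * ‖W (b i)‖ ^ 2 := by
  have h := qEntropy_le_ensemble (conj_mem_posTC hA W)
    (y := fun i => ((√(qf A (b i)) : ℝ) : ℂ) • W (b i)) fun x => by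
      simp_rw [norm_inner_sqrt_smul_sq (qf_nonneg hA.1 _), qf_conj,
        ← ContinuousLinearMap.adjoint_inner_right]
      exact hasSum_qf_eigenbasis hb hA.1 _
  simpa only [norm_sqrt_smul_sq (qf_nonneg hA.1 _)] using h

/-- Entropy does not increase under a two-outcome measurement. -/
theorem qEntropy_conj_add_le {A W V : E →L[ℂ] E} (hA : A ∈ posTC E)
    (h : ∀ x, ‖W x‖ ^ 2 + ‖V x‖ ^ 2 = ‖x‖ ^ 2) :
    qEntropy (W ∘L A ∘L ContinuousLinearMap.adjoint W) +
      qEntropy (V ∘L A ∘L ContinuousLinearMap.adjoint V) ≤ qEntropy A := by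
  obtain ⟨ι, b, hb⟩ := exists_eigenbasis hA
  have hl : ∀ i, 0 ≤ qf A (b i) := fun i => qf_nonneg hA.1 _
  have hs := (hasSum_tr b hA).summable
  have h1 : ∀ i, ‖W (b i)‖ ^ 2 + ‖V (b i)‖ ^ 2 = 1 := fun i => by
    rw [h, b.orthonormal.1 i, one_pow]
  have hsW : Summable fun i => qf A (b i) * ‖W (b i)‖ ^ 2 :=
    hs.of_nonneg_of_le (fun i => mul_nonneg (hl i) (by positivity)) fun i =>
      mul_le_of_le_one_right (hl i) (by nlinarith [h1 i, sq_nonneg ‖V (b i)‖])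
  have hsV : Summable fun i => qf A (b i) * ‖V (b i)‖ ^ 2 :=
    hs.of_nonneg_of_le (fun i => mul_nonneg (hl i) (by positivity)) fun i =>
      mul_le_of_le_one_right (hl i) (by nlinarith [h1 i, sq_nonneg ‖W (b i)‖])
  refine (add_le_add (qEntropy_conj_le hA hb W) (qEntropy_conj_le hA hb V)).trans ?_
  refine (clEntropy_add_le (fun i => mul_nonneg (hl i) (by positivity)) hsW
    (fun i => mul_nonneg (hl i) (by positivity)) hsV).trans_eq ?_
  simp_rw [← mul_add, h1, mul_one]
  exact (qEntropy_eq hA hb).symm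

theorem hasSum_tr_of_hasSum_qf {κ : Type*} {A : E →L[ℂ] E} (hA : A ∈ posTC E)
    {X : κ → (E →L[ℂ] E)} (hX : ∀ i, X i ∈ posTC E)
    (h : ∀ x, HasSum (fun i => qf (X i) x) (qf A x)) : HasSum (fun i => tr (X i)) (tr A) := by
  obtain ⟨w, b, -⟩ := exists_hilbertBasis ℂ E
  refine hasSum_of_tsum_ofReal (fun _ => tr_nonneg _) (tr_nonneg A) ?_
  simp_rw [ofReal_tr (hX _), ofReal_tr hA, traceENN_eq b (hX _).1, traceENN_eq b hA.1]
  rw [ENNReal.tsum_comm]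
  exact tsum_congr fun i => tsum_ofReal_of_hasSum (fun j => qf_nonneg (hX j).1 _) (h _)

/-- Upper bound for the entropy of a countable sum. -/
theorem qEntropy_le_tsum_add {κ : Type*} {A : E →L[ℂ] E} (hA : A ∈ posTC E)
    {X : κ → (E →L[ℂ] E)} (hX : ∀ i, X i ∈ posTC E)
    (h : ∀ x, HasSum (fun i => qf (X i) x) (qf A x)) :
    qEntropy A ≤ ∑' i, qEntropy (X i) + clEntropy fun i => tr (X i) := by
  choose ι b hb using fun i => exists_eigenbasis (hX i)
  have hl : ∀ i j, 0 ≤ qf (X i) (b i j) := fun i j => qf_nonneg (hX i).1 _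
  have hy : ∀ x, HasSum (fun a : Σ i, ι i =>
      ‖(inner ℂ (((√(qf (X a.1) (b a.1 a.2)) : ℝ) : ℂ) • b a.1 a.2) x : ℂ)‖ ^ 2) (qf A x) := by
    intro x
    refine hasSum_of_tsum_ofReal (fun a => by positivity) (qf_nonneg hA.1 x) ?_
    rw [ENNReal.tsum_sigma', ← tsum_ofReal_of_hasSum (fun j => qf_nonneg (hX j).1 _) (h x)]
    refine tsum_congr fun i => tsum_ofReal_of_hasSum (fun j => by positivity) ?_
    simp_rw [norm_inner_sqrt_smul_sq (hl i _)]
    exact hasSum_qf_eigenbasis (hb i) (hX i).1 x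
  have hnorm : (fun a : Σ i, ι i => ‖((√(qf (X a.1) (b a.1 a.2)) : ℝ) : ℂ) • b a.1 a.2‖ ^ 2) =
      fun a => qf (X a.1) (b a.1 a.2) := by
    funext a
    rw [norm_sqrt_smul_sq (hl _ _), (b a.1).orthonormal.1, one_pow, mul_one]
  have h1 := qEntropy_le_ensemble hA hy
  rw [hnorm] at h1
  have h2 := clEntropy_sigma_le (p := fun a : Σ i, ι i => qf (X a.1) (b a.1 a.2))
    (q := fun i => tr (X i)) (fun a => hl _ _)
    (fun i => hasSum_tr (b i) (hX i)) (hasSum_tr_of_hasSum_qf hA hX h).summable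
  refine h1.trans (h2.trans_eq ?_)
  congr 1
  exact tsum_congr fun i => (qEntropy_eq (hX i) (hb i)).symm

theorem qEntropy_add_le {A B : E →L[ℂ] E} (hA : A ∈ posTC E) (hB : B ∈ posTC E) {u v : ℝ}
    (huv : Real.exp (-u) + Real.exp (-v) ≤ 1) :
    qEntropy (A + B) ≤ qEntropy A + qEntropy B + ENNReal.ofReal (u * tr A + v * tr B) := by
  have h := qEntropy_le_tsum_add (add_mem_posTC hA hB) (X := fun i : Bool => if i then A else B)
    (by rintro (_ | _) <;> simpa) fun x => by
      rw [qf_add, add_comm]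
      convert hasSum_fintype (fun i : Bool => qf (if i then A else B) x) using 1
      simp [add_comm]
  refine h.trans ?_
  rw [tsum_fintype, Fintype.sum_bool]
  refine add_le_add (by simp) ((clEntropy_bool_le (fun i => tr_nonneg _) huv).trans_eq (by simp))

end Entropy

section Maps

universe u v

variable {E : Type u} [NormedAddCommGroup E] [InnerProductSpace ℂ E] [CompleteSpace E]
variable {F : Type v} [NormedAddCommGroup F] [InnerProductSpace ℂ F] [CompleteSpace F]

/-- The operator `W A W*`. -/
abbrev conj (W A : E →L[ℂ] E) : E →L[ℂ] E := W ∘L A ∘L ContinuousLinearMap.adjoint W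

theorem sub_mem_posTC {A B : E →L[ℂ] E} (hA : A ∈ posTC E) (hB : B ∈ posTC E)
    (h : ∀ x, qf A x ≤ qf B x) : B - A ∈ posTC E := by
  refine mem_posTC_of_le (isPositive_sub hA.1 hB.1 h) hB fun x => ?_
  rw [qf_sub]
  linarith [qf_nonneg hA.1 x]

theorem tr_sub {A B : E →L[ℂ] E} (hA : A ∈ posTC E) (hB : B ∈ posTC E)
    (h : ∀ x, qf A x ≤ qf B x) : tr (B - A) = tr B - tr A := by
  have := tr_add (sub_mem_posTC hA hB h) hA
  rw [sub_add_cancel] at this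
  linarith

theorem qf_sum {κ : Type*} (X : κ → (E →L[ℂ] E)) (T : Finset κ) (x : E) :
    qf (∑ i ∈ T, X i) x = ∑ i ∈ T, qf (X i) x := map_sum (qfL x) X T

theorem sum_mem_posTC {κ : Type*} {X : κ → (E →L[ℂ] E)} (hX : ∀ i, X i ∈ posTC E)
    (T : Finset κ) : ∑ i ∈ T, X i ∈ posTC E := by
  induction T using Finset.induction_on with
  | empty => simpa using zero_mem_posTC
  | insert a s ha ih => rw [Finset.sum_insert ha]; exact add_mem_posTC (hX a) ih

theorem tr_sum {κ : Type*} {X : κ → (E →L[ℂ] E)} (hX : ∀ i, X i ∈ posTC E)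
    (T : Finset κ) : tr (∑ i ∈ T, X i) = ∑ i ∈ T, tr (X i) := by
  induction T using Finset.induction_on with
  | empty => simpa using tr_zero
  | insert a s ha ih =>
    rw [Finset.sum_insert ha, Finset.sum_insert ha, tr_add (hX a) (sum_mem_posTC hX s), ih]

variable (Φ : TraceMap E F)

theorem TraceMap.map_mem_posTC {X : E →L[ℂ] E} (hX : X ∈ posTC E) : Φ.toFun X ∈ posTC F :=
  ⟨Φ.pos X hX.2 hX.1, Φ.maps_tc X hX.2⟩

theorem TraceMap.map_zero : Φ.toFun 0 = 0 := by
  simpa using Φ.map_smul 0 0 zero_mem_posTC.2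

theorem TraceMap.map_sum {κ : Type*} {X : κ → (E →L[ℂ] E)} (hX : ∀ i, X i ∈ posTC E)
    (T : Finset κ) : Φ.toFun (∑ i ∈ T, X i) = ∑ i ∈ T, Φ.toFun (X i) := by
  induction T using Finset.induction_on with
  | empty => simpa using Φ.map_zero
  | insert a s ha ih =>
    rw [Finset.sum_insert ha, Finset.sum_insert ha, Φ.map_add _ _ (hX a).2 (sum_mem_posTC hX s).2,
      ih]

theorem TraceMap.qf_map_mono {A B : E →L[ℂ] E} (hA : A ∈ posTC E) (hB : B ∈ posTC E)
    (h : ∀ x, qf A x ≤ qf B x) (y : F) : qf (Φ.toFun A) y ≤ qf (Φ.toFun B) y := by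
  have hD := sub_mem_posTC hA hB h
  have h1 : Φ.toFun B = Φ.toFun (B - A) + Φ.toFun A := by
    rw [← Φ.map_add _ _ hD.2 hA.2, sub_add_cancel]
  rw [h1, qf_add]
  linarith [qf_nonneg (Φ.map_mem_posTC hD).1 y]

variable {Φ}

theorem TraceMap.TNI.tr_map_le (hΦ : Φ.TNI) {X : E →L[ℂ] E} (hX : X ∈ posTC E) :
    tr (Φ.toFun X) ≤ tr X :=
  ENNReal.toReal_mono (mem_posTC_iff.1 hX).2 (hΦ X hX.2 hX.1)

theorem TraceMap.TNI.hasSum_qf_map (hΦ : Φ.TNI) {κ : Type*} {A : E →L[ℂ] E} (hA : A ∈ posTC E)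
    {X : κ → (E →L[ℂ] E)} (hX : ∀ i, X i ∈ posTC E)
    (h : ∀ x, HasSum (fun i => qf (X i) x) (qf A x)) (y : F) :
    HasSum (fun i => qf (Φ.toFun (X i)) y) (qf (Φ.toFun A) y) := by
  have htr := hasSum_tr_of_hasSum_qf hA hX h
  have hle : ∀ (T : Finset κ) x, qf (∑ i ∈ T, X i) x ≤ qf A x := fun T x => by
    rw [qf_sum]
    exact sum_le_hasSum T (fun i _ => qf_nonneg (hX i).1 x) (h x)
  have hlim : Tendsto (fun T : Finset κ => (tr A - ∑ i ∈ T, tr (X i)) * ‖y‖ ^ 2) atTop (𝓝 0) := by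
    have h1 : Tendsto (fun T : Finset κ => ∑ i ∈ T, tr (X i)) atTop (𝓝 (tr A)) := htr
    simpa using (h1.const_sub (tr A)).mul_const (‖y‖ ^ 2)
  have hlim2 : Tendsto (fun T : Finset κ => qf (Φ.toFun A) y - ∑ i ∈ T, qf (Φ.toFun (X i)) y)
      atTop (𝓝 0) := by
    have hR : ∀ T : Finset κ, qf (Φ.toFun A) y - ∑ i ∈ T, qf (Φ.toFun (X i)) y =
        qf (Φ.toFun (A - ∑ i ∈ T, X i)) y := fun T => by
      have hD := sub_mem_posTC (sum_mem_posTC hX T) hA (hle T)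
      rw [← qf_sum, ← Φ.map_sum hX, sub_eq_iff_eq_add, ← qf_add,
        ← Φ.map_add _ _ hD.2 (sum_mem_posTC hX T).2, sub_add_cancel]
    refine squeeze_zero (fun T => ?_) (fun T => ?_) hlim
    · rw [hR]
      exact qf_nonneg (Φ.map_mem_posTC (sub_mem_posTC (sum_mem_posTC hX T) hA (hle T))).1 _
    · have hD := sub_mem_posTC (sum_mem_posTC hX T) hA (hle T)
      rw [hR, ← tr_sum hX, ← tr_sub (sum_mem_posTC hX T) hA (hle T)]
      refine (qf_le_tr (Φ.map_mem_posTC hD) y).trans ?_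
      gcongr
      exact hΦ.tr_map_le hD
  have := hlim2.const_sub (qf (Φ.toFun A) y)
  simpa [HasSum] using this

theorem outEntropy_smul {X : E →L[ℂ] E} (hX : X ∈ posTC E) {c : ℝ} (hc : 0 ≤ c) :
    outEntropy Φ ((c : ℂ) • X) = ENNReal.ofReal c * outEntropy Φ X := by
  rw [outEntropy, Φ.map_smul _ _ hX.2, qEntropy_smul (Φ.map_mem_posTC hX) hc, outEntropy]

theorem outEntropy_mono {A B : E →L[ℂ] E} (hA : A ∈ posTC E) (hB : B ∈ posTC E)
    (h : ∀ x, qf A x ≤ qf B x) : outEntropy Φ A ≤ outEntropy Φ B :=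
  qEntropy_mono (Φ.map_mem_posTC hA).1 (Φ.map_mem_posTC hB) (Φ.qf_map_mono hA hB h)

/-- The output entropy exceeds the entropy at most by its bound on pure states. -/
theorem TraceMap.TNI.outEntropy_le (hΦ : Φ.TNI) {C : ℝ}
    (hC : ∀ ρ ∈ pureStates E, outEntropy Φ ρ ≤ ENNReal.ofReal C) {A : E →L[ℂ] E}
    (hA : A ∈ posTC E) :
    outEntropy Φ A ≤ ENNReal.ofReal C * ENNReal.ofReal (tr A) + qEntropy A := by
  obtain ⟨ι, b, hb⟩ := exists_eigenbasis hA
  have hl : ∀ i, 0 ≤ qf A (b i) := fun i => qf_nonneg hA.1 _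
  set X : ι → (E →L[ℂ] E) := fun i => (qf A (b i) : ℂ) • rankOne (b i) with hXdef
  have hX : ∀ i, X i ∈ posTC E := fun i => smul_mem_posTC (rankOne_mem_posTC _) (hl i)
  have hXs : ∀ x, HasSum (fun i => qf (X i) x) (qf A x) := fun x => by
    simp_rw [hXdef, qf_smul, qf_rankOne]
    exact hasSum_qf_eigenbasis hb hA.1 x
  have htr : ∀ i, tr (X i) = qf A (b i) := fun i => by
    rw [hXdef, tr_smul (rankOne_mem_posTC _) (hl i), tr_rankOne, b.orthonormal.1]; simp
  refine (qEntropy_le_tsum_add (Φ.map_mem_posTC hA) (fun i => Φ.map_mem_posTC (hX i))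
    (hΦ.hasSum_qf_map hA hX hXs)).trans (add_le_add ?_ ?_)
  · have h1 := tsum_ofReal_of_hasSum hl (hasSum_tr b hA)
    rw [← h1, ← ENNReal.tsum_mul_left]
    refine ENNReal.tsum_le_tsum fun i => ?_
    have h2 := outEntropy_smul (Φ := Φ) (rankOne_mem_posTC (b i)) (hl i)
    rw [outEntropy] at h2
    rw [h2, mul_comm]
    gcongr
    exact hC _ ⟨b i, b.orthonormal.1 i, rfl⟩
  · rw [qEntropy_eq hA hb]
    refine clEntropy_mono (fun i => tr_nonneg _) (fun i => ?_) (hasSum_tr b hA).summable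
    exact (hΦ.tr_map_le (hX i)).trans_eq (htr i)

theorem qf_le_conj_add_conj {A W V : E →L[ℂ] E} (hA : A.IsPositive)
    (hWV : W + V = ContinuousLinearMap.id ℂ E) {t : ℝ} (ht : 0 < t) (x : E) :
    qf A x ≤ (1 + t) * qf (conj W A) x + (1 + t⁻¹) * qf (conj V A) x := by
  obtain ⟨S, hS, hSA⟩ := exists_sqrt hA
  have hx : x = ContinuousLinearMap.adjoint W x + ContinuousLinearMap.adjoint V x := by
    have h := congrArg ContinuousLinearMap.adjoint hWV
    rw [map_add, ContinuousLinearMap.adjoint_id] at h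
    simpa using (congrArg (fun Z : E →L[ℂ] E => Z x) h).symm
  rw [qf_conj, qf_conj, qf_eq_norm_sq hS hSA, qf_eq_norm_sq hS hSA, qf_eq_norm_sq hS hSA]
  conv_lhs => rw [hx, map_add]
  set p := S (ContinuousLinearMap.adjoint W x)
  set q := S (ContinuousLinearMap.adjoint V x)
  have h1 := norm_add_le p q
  have h2 : ‖p + q‖ ^ 2 ≤ (‖p‖ + ‖q‖) ^ 2 := by gcongr
  have h3 : 0 ≤ t⁻¹ * (t * ‖p‖ - ‖q‖) ^ 2 := by positivity
  have h4 : t⁻¹ * (t * ‖p‖ - ‖q‖) ^ 2 = t * ‖p‖ ^ 2 - 2 * ‖p‖ * ‖q‖ + t⁻¹ * ‖q‖ ^ 2 := by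
    field_simp
    ring
  nlinarith

/-- The properties of an entropy-like functional on the positive trace class cone that
force its continuity. -/
structure IsEntropyLike (K : (E →L[ℂ] E) → ℝ≥0∞) : Prop where
  mono : ∀ {A B : E →L[ℂ] E}, A ∈ posTC E → B ∈ posTC E → (∀ x, qf A x ≤ qf B x) → K A ≤ K B
  smul_le : ∀ {A : E →L[ℂ] E}, A ∈ posTC E → ∀ {c : ℝ}, 0 < c →
    K ((c : ℂ) • A) ≤ ENNReal.ofReal c * K A
  split : ∀ {A W V : E →L[ℂ] E}, A ∈ posTC E → W + V = ContinuousLinearMap.id ℂ E →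
    ∀ {t u v : ℝ}, 0 < t → Real.exp (-u) + Real.exp (-v) ≤ 1 →
    K A ≤ ENNReal.ofReal (1 + t) * K (conj W A) + ENNReal.ofReal (1 + t⁻¹) * K (conj V A) +
      ENNReal.ofReal (u * (1 + t) * tr (conj W A) + v * (1 + t⁻¹) * tr (conj V A))
  rank_le : ∀ m : ℕ, ∃ c : ℝ, 0 ≤ c ∧ ∀ X : E →L[ℂ] E, X.IsPositive → rankLE X m →
    K X ≤ ENNReal.ofReal (c * tr X)

theorem nonneg_of_exp_neg_le {u v : ℝ} (huv : Real.exp (-u) + Real.exp (-v) ≤ 1) :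
    0 ≤ u ∧ 0 ≤ v := by
  constructor
  · have h : Real.exp (-u) ≤ 1 := by linarith [Real.exp_pos (-v)]
    linarith [Real.exp_le_one_iff.1 h]
  · have h : Real.exp (-v) ≤ 1 := by linarith [Real.exp_pos (-u)]
    linarith [Real.exp_le_one_iff.1 h]

theorem TraceMap.TNI.outEntropy_isEntropyLike (hΦ : Φ.TNI) {C : ℝ} (hC0 : 0 ≤ C)
    (hC : ∀ ρ ∈ pureStates E, outEntropy Φ ρ ≤ ENNReal.ofReal C) :
    IsEntropyLike (outEntropy Φ) where
  mono := outEntropy_mono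
  smul_le hA _ hc := (outEntropy_smul hA hc.le).le
  split {A W V} hA hWV t u v ht huv := by
    obtain ⟨hu, hv⟩ := nonneg_of_exp_neg_le huv
    have hW := conj_mem_posTC hA W
    have hV := conj_mem_posTC hA V
    have ht1 : 0 ≤ 1 + t := by positivity
    have ht2 : 0 ≤ 1 + t⁻¹ := by positivity
    have hW' := smul_mem_posTC hW ht1
    have hV' := smul_mem_posTC hV ht2
    have h1 : outEntropy Φ A ≤
        outEntropy Φ (((1 + t : ℝ) : ℂ) • conj W A + ((1 + t⁻¹ : ℝ) : ℂ) • conj V A) :=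
      outEntropy_mono hA (add_mem_posTC hW' hV') fun x => by
        rw [qf_add, qf_smul, qf_smul]; exact qf_le_conj_add_conj hA.1 hWV ht x
    refine h1.trans ?_
    rw [outEntropy, Φ.map_add _ _ hW'.2 hV'.2]
    refine (qEntropy_add_le (Φ.map_mem_posTC hW') (Φ.map_mem_posTC hV') huv).trans ?_
    have h2 := outEntropy_smul (Φ := Φ) hW ht1
    have h3 := outEntropy_smul (Φ := Φ) hV ht2
    rw [outEntropy] at h2 h3
    rw [h2, h3]
    refine add_le_add le_rfl (ENNReal.ofReal_le_ofReal ?_)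
    have h4 := hΦ.tr_map_le hW'
    have h5 := hΦ.tr_map_le hV'
    rw [tr_smul hW ht1] at h4
    rw [tr_smul hV ht2] at h5
    nlinarith [mul_le_mul_of_nonneg_left h4 hu, mul_le_mul_of_nonneg_left h5 hv]
  rank_le m := ⟨C + m, by positivity, fun X hX hm => by
    refine (hΦ.outEntropy_le hC (mem_posTC_of_rankLE hX hm)).trans ?_
    refine (add_le_add le_rfl (qEntropy_le_rank hX hm)).trans_eq ?_
    rw [ENNReal.ofReal_mul (by positivity), ENNReal.ofReal_add hC0 (by positivity),
      ENNReal.ofReal_natCast, add_mul]⟩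

end Maps

section Approximators

universe u v

variable {E : Type u} [NormedAddCommGroup E] [InnerProductSpace ℂ E] [CompleteSpace E]
variable {F : Type v} [NormedAddCommGroup F] [InnerProductSpace ℂ F] [CompleteSpace F]
variable {Φ : TraceMap E F} {k : ℕ}

theorem outEntropy_zero : outEntropy Φ 0 = 0 := by
  have := outEntropy_smul (Φ := Φ) (zero_mem_posTC (E := E)) (le_refl (0 : ℝ))
  simpa using this

/-- A countable decomposition into operators of rank at most `k`, with the weights absorbed. -/
theorem tsum_outEntropy_le_kApprox {κ : Type*} [Countable κ] {A : E →L[ℂ] E}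
    {Y : κ → (E →L[ℂ] E)} (hpos : ∀ i, (Y i).IsPositive) (hrank : ∀ i, rankLE (Y i) k)
    (hY : HasSum Y A) : ∑' i, outEntropy Φ (Y i) ≤ kApprox Φ.toFun k A := by
  obtain ⟨enc, henc⟩ := exists_injective_nat κ
  set Z : ℕ → (E →L[ℂ] E) := Function.extend enc Y 0 with hZ
  have hZY : ∀ i, Z (enc i) = Y i := fun i => henc.extend_apply _ _ _
  have hcases : ∀ n, (∃ i, Z n = Y i) ∨ Z n = 0 := fun n => by
    by_cases hn : ∃ i, enc i = n
    · obtain ⟨i, rfl⟩ := hn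
      exact Or.inl ⟨i, hZY i⟩
    · exact Or.inr (Function.extend_apply' _ _ _ hn)
  have hZpos : ∀ n, (Z n).IsPositive := fun n => by
    rcases hcases n with ⟨i, h⟩ | h <;> rw [h]
    exacts [hpos i, zero_mem_posTC.1]
  have hZrank : ∀ n, rankLE (Z n) k := fun n => by
    rcases hcases n with ⟨i, h⟩ | h <;> rw [h]
    exacts [hrank i, rankLE_zero k]
  have hw : ∀ n : ℕ, (0 : ℝ) < 1 / 2 / 2 ^ n := fun n => by positivity
  let d : Decomp k A :=
    { π := fun n => 1 / 2 / 2 ^ n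
      op := fun n => (((1 / 2 / 2 ^ n : ℝ)⁻¹ : ℝ) : ℂ) • Z n
      π_nonneg := fun n => (hw n).le
      π_sum := hasSum_geometric_two' 1
      op_pos := fun n => isPositive_real_smul (hZpos n) (inv_nonneg.2 (hw n).le)
      op_rank := fun n => rankLE_smul (hZrank n) _
      sum_eq := by
        have h : (fun n : ℕ => (1 / 2 / 2 ^ n : ℝ) •
            ((((1 / 2 / 2 ^ n : ℝ)⁻¹ : ℝ) : ℂ) • Z n)) = Z := by
          funext n
          rw [Complex.coe_smul, smul_smul, mul_inv_cancel₀ (hw n).ne', one_smul]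
        rw [h]
        exact (hasSum_extend_zero henc).2 hY }
  calc ∑' i, outEntropy Φ (Y i) = ∑' i, outEntropy Φ (Z (enc i)) := by simp_rw [hZY]
    _ ≤ ∑' n, outEntropy Φ (Z n) :=
      ENNReal.tsum_comp_le_tsum_of_injective henc (fun n => outEntropy Φ (Z n))
    _ = ∑' n, ENNReal.ofReal (d.π n) * qEntropy (Φ.toFun (d.op n)) := by
      refine tsum_congr fun n => ?_
      have h := outEntropy_smul (Φ := Φ) (mem_posTC_of_rankLE (hZpos n) (hZrank n))
        (inv_nonneg.2 (hw n).le)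
      change _ = ENNReal.ofReal (1 / 2 / 2 ^ n) *
        outEntropy Φ ((((1 / 2 / 2 ^ n : ℝ)⁻¹ : ℝ) : ℂ) • Z n)
      rw [h, ← mul_assoc, ← ENNReal.ofReal_mul (hw n).le, mul_inv_cancel₀ (hw n).ne']
      simp
    _ ≤ kApprox Φ.toFun k A :=
      le_iSup (fun d : Decomp k A => ∑' i, ENNReal.ofReal (d.π i) * qEntropy (Φ.toFun (d.op i))) d

theorem kApprox_le_of_forall {A : E →L[ℂ] E} {M : ℝ≥0∞}
    (h : ∀ Y : ℕ → (E →L[ℂ] E), (∀ i, (Y i).IsPositive) → (∀ i, rankLE (Y i) k) → HasSum Y A →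
      ∑' i, outEntropy Φ (Y i) ≤ M) : kApprox Φ.toFun k A ≤ M := by
  refine iSup_le fun d => ?_
  refine le_of_eq_of_le ?_ (h (fun i => ((d.π i : ℝ) : ℂ) • d.op i)
    (fun i => isPositive_real_smul (d.op_pos i) (d.π_nonneg i))
    (fun i => rankLE_smul (d.op_rank i) _) ?_)
  · exact tsum_congr fun i => (outEntropy_smul (mem_posTC_of_rankLE (d.op_pos i) (d.op_rank i))
      (d.π_nonneg i)).symm
  · simpa only [Complex.coe_smul] using d.sum_eq

theorem hasSum_tr_of_hasSum {κ : Type*} {A : E →L[ℂ] E} (hA : A ∈ posTC E) {Y : κ → (E →L[ℂ] E)}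
    (hY : ∀ i, Y i ∈ posTC E) (h : HasSum Y A) : HasSum (fun i => tr (Y i)) (tr A) :=
  hasSum_tr_of_hasSum_qf hA hY (hasSum_qf h)

theorem TraceMap.TNI.kApprox_le (hΦ : Φ.TNI) {C : ℝ} (hC0 : 0 ≤ C)
    (hC : ∀ ρ ∈ pureStates E, outEntropy Φ ρ ≤ ENNReal.ofReal C) {A : E →L[ℂ] E}
    (hA : A ∈ posTC E) : kApprox Φ.toFun k A ≤ ENNReal.ofReal ((C + k) * tr A) := by
  refine kApprox_le_of_forall fun Y hpos hrank hY => ?_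
  have hY' := fun i => mem_posTC_of_rankLE (hpos i) (hrank i)
  have h1 := (hasSum_tr_of_hasSum hA hY' hY).mul_left (C + k)
  rw [← tsum_ofReal_of_hasSum (fun i => mul_nonneg (by positivity) (tr_nonneg _)) h1]
  refine ENNReal.tsum_le_tsum fun i => (hΦ.outEntropy_le hC (hY' i)).trans ?_
  refine (add_le_add le_rfl (qEntropy_le_rank (hpos i) (hrank i))).trans_eq ?_
  rw [ENNReal.ofReal_mul (by positivity), ENNReal.ofReal_add hC0 (by positivity),
    ENNReal.ofReal_natCast, add_mul]

theorem norm_rankOne_le (x : E) : ‖rankOne x‖ ≤ ‖x‖ * ‖x‖ := by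
  rw [rankOne, ContinuousLinearMap.norm_smulRight_apply, innerSL_apply_norm]

theorem hasSum_eigenbasis {ι : Type*} {A : E →L[ℂ] E} (hA : A ∈ posTC E)
    {b : HilbertBasis ι ℂ E} (hb : ∀ i, A (b i) = (qf A (b i) : ℂ) • b i) :
    HasSum (fun i => (qf A (b i) : ℂ) • rankOne (b i)) A := by
  have hsum : Summable (fun i => (qf A (b i) : ℂ) • rankOne (b i)) := by
    refine Summable.of_norm_bounded (hasSum_tr b hA).summable fun i => ?_
    rw [norm_smul, Complex.norm_real, Real.norm_of_nonneg (qf_nonneg hA.1 _)]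
    have h := norm_rankOne_le (b i)
    rw [b.orthonormal.1 i, mul_one] at h
    exact mul_le_of_le_one_right (qf_nonneg hA.1 _) h
  have hlim : ∑' i, (qf A (b i) : ℂ) • rankOne (b i) = A := by
    refine ContinuousLinearMap.ext_on
      (Submodule.dense_iff_topologicalClosure_eq_top.2 b.dense_span) ?_
    rintro _ ⟨j, rfl⟩
    have h1 := hsum.hasSum.mapL (ContinuousLinearMap.apply ℂ E (b j))
    have h2 : HasSum (fun i => (qf A (b i) : ℂ) • rankOne (b i) (b j))
        ((qf A (b j) : ℂ) • rankOne (b j) (b j)) :=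
      hasSum_single j fun i hi => by rw [rankOne_apply, b.orthonormal.2 hi]; simp
    rw [rankOne_apply, inner_self_eq_norm_sq_to_K, b.orthonormal.1 j] at h2
    simp only [RCLike.ofReal_one, one_pow, one_smul] at h2
    rw [hb j]
    exact h1.unique h2
  have h := hsum.hasSum
  rwa [hlim] at h

theorem exists_rankOne_decomposition {A : E →L[ℂ] E} (hA : A ∈ posTC E) :
    ∃ (κ : Type u) (_ : Countable κ) (Y : κ → (E →L[ℂ] E)), (∀ i, (Y i).IsPositive) ∧
      (∀ i, rankLE (Y i) 1) ∧ HasSum Y A := by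
  obtain ⟨ι, b, hb⟩ := exists_eigenbasis hA
  have hc := (hasSum_tr b hA).summable.countable_support
  refine ⟨Function.support fun i => qf A (b i), hc.to_subtype,
    fun i => (qf A (b i) : ℂ) • rankOne (b i),
    fun i => isPositive_real_smul (rankOne_isPositive _) (qf_nonneg hA.1 _),
    fun i => rankLE_smul (rankLE_rankOne _) _, ?_⟩
  have h := hasSum_eigenbasis hA hb
  refine (hasSum_subtype_iff_of_support_subset (f := fun i => (qf A (b i) : ℂ) • rankOne (b i))
    fun i hi => ?_).2 h
  rw [Function.mem_support] at hi ⊢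
  exact fun h0 => hi (by rw [h0]; simp)

theorem TraceMap.TNI.kApprox_isEntropyLike (hΦ : Φ.TNI) {C : ℝ} (hC0 : 0 ≤ C)
    (hC : ∀ ρ ∈ pureStates E, outEntropy Φ ρ ≤ ENNReal.ofReal C) (hk : 1 ≤ k) :
    IsEntropyLike (kApprox Φ.toFun k) where
  mono {A B} hA hB h := by
    refine kApprox_le_of_forall fun Y hpos hrank hY => ?_
    obtain ⟨κ, _, Z, hZpos, hZrank, hZ⟩ := exists_rankOne_decomposition (sub_mem_posTC hA hB h)
    have hs : HasSum (Sum.elim Y Z) B := by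
      have := HasSum.sum (f := Sum.elim Y Z) hY hZ
      simpa using this
    refine le_trans ?_ (tsum_outEntropy_le_kApprox (Φ := Φ) (k := k) ?_ ?_ hs)
    · exact ENNReal.tsum_comp_le_tsum_of_injective Sum.inl_injective
        (fun i => outEntropy Φ (Sum.elim Y Z i))
    · rintro (i | i)
      exacts [hpos i, hZpos i]
    · rintro (i | i)
      exacts [hrank i, rankLE_mono (hZrank i) hk]
  smul_le {A} hA c hc := by
    refine kApprox_le_of_forall fun Y hpos hrank hY => ?_
    have hs : HasSum (fun i => ((c⁻¹ : ℝ) : ℂ) • Y i) A := by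
      have := hY.const_smul ((c⁻¹ : ℝ) : ℂ)
      rwa [smul_smul, ← Complex.ofReal_mul, inv_mul_cancel₀ hc.ne', Complex.ofReal_one,
        one_smul] at this
    have h1 := tsum_outEntropy_le_kApprox (Φ := Φ) (k := k)
      (fun i => isPositive_real_smul (hpos i) (inv_nonneg.2 hc.le))
      (fun i => rankLE_smul (hrank i) _) hs
    refine le_trans (le_of_eq ?_) (mul_le_mul_right h1 _)
    rw [← ENNReal.tsum_mul_left]
    refine tsum_congr fun i => ?_
    rw [outEntropy_smul (mem_posTC_of_rankLE (hpos i) (hrank i)) (inv_nonneg.2 hc.le), ← mul_assoc,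
      ← ENNReal.ofReal_mul hc.le, mul_inv_cancel₀ hc.ne', ENNReal.ofReal_one, one_mul]
  split {A W V} hA hWV t u v ht huv := by
    obtain ⟨hu, hv⟩ := nonneg_of_exp_neg_le huv
    refine kApprox_le_of_forall fun Y hpos hrank hY => ?_
    have hY' := fun i => mem_posTC_of_rankLE (hpos i) (hrank i)
    have hcs : ∀ W : E →L[ℂ] E, HasSum (fun i => conj W (Y i)) (conj W A) := fun W =>
      (hY.mapL ((ContinuousLinearMap.compL ℂ E E E).flip (ContinuousLinearMap.adjoint W))).mapL
        (ContinuousLinearMap.compL ℂ E E E W)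
    have hke : ∀ W : E →L[ℂ] E, ∑' i, outEntropy Φ (conj W (Y i)) ≤ kApprox Φ.toFun k (conj W A) :=
      fun W => tsum_outEntropy_le_kApprox (fun i => (conj_mem_posTC (hY' i) W).1)
        (fun i => rankLE_conj (hrank i) _ _) (hcs W)
    have htr : ∀ W : E →L[ℂ] E, HasSum (fun i => tr (conj W (Y i))) (tr (conj W A)) := fun W =>
      hasSum_tr_of_hasSum (conj_mem_posTC hA W) (fun i => conj_mem_posTC (hY' i) W) (hcs W)
    have hrem := ((htr W).mul_left (u * (1 + t))).add ((htr V).mul_left (v * (1 + t⁻¹)))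
    have hnn : ∀ i, 0 ≤ u * (1 + t) * tr (conj W (Y i)) + v * (1 + t⁻¹) * tr (conj V (Y i)) :=
      fun i => by
        have := tr_nonneg (conj W (Y i))
        have := tr_nonneg (conj V (Y i))
        positivity
    rw [← tsum_ofReal_of_hasSum hnn hrem]
    refine (ENNReal.tsum_le_tsum fun i =>
      (hΦ.outEntropy_isEntropyLike hC0 hC).split (hY' i) hWV ht huv).trans ?_
    rw [ENNReal.tsum_add, ENNReal.tsum_add, ENNReal.tsum_mul_left, ENNReal.tsum_mul_left]
    gcongr
    exacts [hke W, hke V]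
  rank_le m := ⟨C + k, by positivity, fun X hX hm => hΦ.kApprox_le hC0 hC (mem_posTC_of_rankLE hX hm)⟩

end Approximators

section Truncation

universe u

variable {E : Type u} [NormedAddCommGroup E] [InnerProductSpace ℂ E] [CompleteSpace E]
variable {ι : Type*} (b : HilbertBasis ι ℂ E) (T : Finset ι)

/-- The orthogonal projection onto the span of finitely many basis vectors. -/
def proj : E →L[ℂ] E := diagOp b T 1

/-- The orthogonal projection complementary to `proj`. -/
def coproj : E →L[ℂ] E := ContinuousLinearMap.id ℂ E - proj b T

theorem proj_add_coproj : proj b T + coproj b T = ContinuousLinearMap.id ℂ E :=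
  add_sub_cancel _ _

theorem adjoint_proj : ContinuousLinearMap.adjoint (proj b T) = proj b T := adjoint_diagOp _ _ _

theorem adjoint_coproj : ContinuousLinearMap.adjoint (coproj b T) = coproj b T := by
  rw [coproj, map_sub, adjoint_proj, ContinuousLinearMap.adjoint_id]

theorem inner_proj (x : E) (j : ι) :
    (inner ℂ (b j) (proj b T x) : ℂ) = if j ∈ T then inner ℂ (b j) x else 0 := by
  rw [proj, inner_diagOp b.orthonormal]; simp

theorem inner_coproj (x : E) (j : ι) :
    (inner ℂ (b j) (coproj b T x) : ℂ) = if j ∈ T then 0 else inner ℂ (b j) x := by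
  rw [coproj, sub_apply, inner_sub_right, inner_proj]
  split_ifs <;> simp

theorem norm_sq_proj_add (x : E) : ‖proj b T x‖ ^ 2 + ‖coproj b T x‖ ^ 2 = ‖x‖ ^ 2 := by
  have h := (hasSum_norm_inner_sq b (proj b T x)).add (hasSum_norm_inner_sq b (coproj b T x))
  refine h.unique ((hasSum_norm_inner_sq b x).congr_fun ?_)
  intro i
  rw [inner_proj, inner_coproj]
  split_ifs <;> simp

theorem coproj_apply_basis (j : ι) : coproj b T (b j) = if j ∈ T then 0 else b j := by
  rw [coproj, sub_apply, proj, diagOp_apply_basis b.orthonormal]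
  split_ifs <;> simp

variable {b T}

theorem hasSum_tr_conj_coproj {B : E →L[ℂ] E} (hB : B ∈ posTC E) :
    HasSum (fun i => if i ∈ T then 0 else qf B (b i)) (tr (conj (coproj b T) B)) := by
  refine (hasSum_tr b (conj_mem_posTC hB (coproj b T))).congr_fun fun i => ?_
  rw [qf_conj, adjoint_coproj, coproj_apply_basis]
  split_ifs <;> simp [qf]

variable {A B : E →L[ℂ] E}

theorem norm_sub_lt {δ : ℝ} (h : traceNorm (B - A) < ENNReal.ofReal δ) : ‖B - A‖ < δ :=
  ((ENNReal.ofReal_lt_ofReal_iff_of_nonneg (norm_nonneg _)).1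
    ((ofReal_norm_le_traceNorm _).trans_lt h))

theorem tr_conj_coproj_le (hA : A ∈ posTC E) (hB : B ∈ posTC E) {δ : ℝ} (hδ : 0 ≤ δ)
    (h : traceNorm (B - A) ≤ ENNReal.ofReal δ) :
    tr (conj (coproj b T) B) ≤ tr (conj (coproj b T) A) + δ := by
  have h1 := (hasSum_tr_conj_coproj (b := b) (T := T) hB).sub
    (hasSum_tr_conj_coproj (b := b) (T := T) hA)
  have h2 : tr (conj (coproj b T) B) - tr (conj (coproj b T) A) ≤ δ := by
    refine hasSum_le_of_sum_le h1 fun S => ?_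
    have h3 := (sum_norm_inner_le_traceNorm b.orthonormal (B - A) S).trans h
    rw [← ENNReal.ofReal_sum_of_nonneg fun i _ => norm_nonneg _,
      ENNReal.ofReal_le_ofReal_iff hδ] at h3
    refine (Finset.sum_le_sum fun i _ => ?_).trans h3
    split_ifs
    · simp
    · rw [← qf_sub]
      exact Complex.re_le_norm _
  linarith

theorem tr_le_add (hA : A ∈ posTC E) (hB : B ∈ posTC E) {δ : ℝ} (hδ : 0 ≤ δ)
    (h : traceNorm (B - A) ≤ ENNReal.ofReal δ) : tr B ≤ tr A + δ := by
  obtain ⟨w, b, -⟩ := exists_hilbertBasis ℂ E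
  have h1 := tr_conj_coproj_le (b := b) (T := ∅) hA hB hδ h
  have h2 : coproj b ∅ = ContinuousLinearMap.id ℂ E := by simp [coproj, proj, diagOp]
  have h3 : ∀ X : E →L[ℂ] E, conj (coproj b ∅) X = X := fun X => by
    ext x
    simp [h2, ContinuousLinearMap.adjoint_id]
  rwa [h3, h3] at h1

theorem qf_eq_sum_of_inner_eq_zero
    (hb : ∀ i, A (b i) = (qf A (b i) : ℂ) • b i) (hA : A.IsPositive) {z : E}
    (hz : ∀ i ∉ T, (inner ℂ (b i) z : ℂ) = 0) :
    qf A z = ∑ i ∈ T, qf A (b i) * ‖(inner ℂ (b i) z : ℂ)‖ ^ 2 :=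
  (hasSum_qf_eigenbasis hb hA z).unique (hasSum_sum_of_ne_finset_zero fun i hi => by simp [hz i hi])

theorem abs_qf_sub_le
    (hb : ∀ i, A (b i) = (qf A (b i) : ℂ) • b i) (hA : A.IsPositive) {c t : ℝ} (hcT : ∀ i ∈ T, c ≤ qf A (b i))
    (ht : 0 ≤ t) (hBA : ‖B - A‖ ≤ t * c) {z : E} (hz : ∀ i ∉ T, (inner ℂ (b i) z : ℂ) = 0) :
    |qf B z - qf A z| ≤ t * qf A z := by
  have h1 : c * ‖z‖ ^ 2 ≤ qf A z := by
    rw [qf_eq_sum_of_inner_eq_zero hb hA hz, (hasSum_norm_inner_sq b z).unique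
      (hasSum_sum_of_ne_finset_zero (s := T) fun i hi => by simp [hz i hi]), Finset.mul_sum]
    exact Finset.sum_le_sum fun i hi => by gcongr; exact hcT i hi
  rw [← qf_sub]
  refine (abs_qf_le _ _).trans ?_
  calc ‖B - A‖ * ‖z‖ ^ 2 ≤ t * c * ‖z‖ ^ 2 := by gcongr
    _ = t * (c * ‖z‖ ^ 2) := by ring
    _ ≤ t * qf A z := by gcongr

theorem qf_proj_add_qf_coproj
    (hb : ∀ i, A (b i) = (qf A (b i) : ℂ) • b i) (hA : A.IsPositive) (x : E) :
    qf A (proj b T x) + qf A (coproj b T x) = qf A x := by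
  have h := (hasSum_qf_eigenbasis hb hA (proj b T x)).add
    (hasSum_qf_eigenbasis hb hA (coproj b T x))
  refine h.unique ((hasSum_qf_eigenbasis hb hA x).congr_fun fun i => ?_)
  rw [inner_proj, inner_coproj]
  split_ifs <;> simp

theorem qf_conj_proj_le
    (hb : ∀ i, A (b i) = (qf A (b i) : ℂ) • b i) (hA : A.IsPositive) {c t : ℝ} (hcT : ∀ i ∈ T, c ≤ qf A (b i))
    (ht : 0 ≤ t) (hBA : ‖B - A‖ ≤ t * c) (x : E) :
    qf (conj (proj b T) B) x ≤ (1 + t) * qf A x := by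
  rw [qf_conj, adjoint_proj]
  have h := abs_le.1 (abs_qf_sub_le hb hA hcT ht hBA (z := proj b T x) fun i hi => by
    rw [inner_proj, if_neg hi])
  have h1 := qf_proj_add_qf_coproj (T := T) hb hA x
  have h2 := qf_nonneg hA (coproj b T x)
  nlinarith [h.2]

theorem le_qf_conj_proj
    (hb : ∀ i, A (b i) = (qf A (b i) : ℂ) • b i) (hA : A.IsPositive) {c t : ℝ} (hcT : ∀ i ∈ T, c ≤ qf A (b i))
    (ht : 0 ≤ t) (hBA : ‖B - A‖ ≤ t * c) (x : E) :
    (1 - t) * qf (conj (proj b T) A) x ≤ qf (conj (proj b T) B) x := by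
  rw [qf_conj, qf_conj, adjoint_proj]
  have h := abs_le.1 (abs_qf_sub_le hb hA hcT ht hBA (z := proj b T x) fun i hi => by
    rw [inner_proj, if_neg hi])
  nlinarith [h.1]

theorem conj_proj_eq_diagOp
    (hb : ∀ i, A (b i) = (qf A (b i) : ℂ) • b i) :
    conj (proj b T) A = diagOp b T fun i => qf A (b i) := by
  ext x
  change proj b T (A (ContinuousLinearMap.adjoint (proj b T) x)) = _
  rw [adjoint_proj, proj, diagOp_apply b T 1 x,
    diagOp_apply b T (fun i => qf A (b i)) x, map_sum, map_sum]
  refine Finset.sum_congr rfl fun i hi => ?_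
  rw [map_smul, hb, map_smul, map_smul, diagOp_apply_basis b.orthonormal, if_pos hi]
  simp only [Pi.one_apply, Complex.ofReal_one, one_mul, one_smul, smul_smul]
  rw [mul_comm]

/-- The compression of `A` transported by `B A⁻¹` is dominated by `B`. -/
theorem qf_conj_comp_diagOp_inv_le
    (hb : ∀ i, A (b i) = (qf A (b i) : ℂ) • b i) (hA : A.IsPositive) (hB : B.IsPositive) {c t : ℝ} (hc : 0 < c)
    (hcT : ∀ i ∈ T, c ≤ qf A (b i)) (ht : 0 ≤ t) (hBA : ‖B - A‖ ≤ t * c) (x : E) :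
    qf (conj (B ∘L diagOp b T fun i => (qf A (b i))⁻¹) (diagOp b T fun i => qf A (b i))) x ≤
      (1 + t) * qf B x := by
  set G := diagOp b T fun i => (qf A (b i))⁻¹ with hG
  have hadj : ContinuousLinearMap.adjoint (B ∘L G) = G ∘L B := by
    rw [ContinuousLinearMap.adjoint_comp, hG, adjoint_diagOp, hB.isSelfAdjoint.adjoint_eq]
  rw [qf_conj, hadj]
  change qf _ (G (B x)) ≤ _
  set z := G (B x) with hz
  have hzi : ∀ i ∉ T, (inner ℂ (b i) z : ℂ) = 0 := fun i hi => by
    rw [hz, hG, inner_diagOp b.orthonormal, if_neg hi]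
  have hN : qf (diagOp b T fun i => qf A (b i)) z = qf A z := by
    rw [qf_diagOp, qf_eq_sum_of_inner_eq_zero hb hA hzi]
  have hN2 : qf A z = qf G (B x) := by
    rw [qf_eq_sum_of_inner_eq_zero hb hA hzi, hG, qf_diagOp]
    refine Finset.sum_congr rfl fun i hi => ?_
    have hi' : 0 < qf A (b i) := hc.trans_le (hcT i hi)
    rw [hz, hG, inner_diagOp b.orthonormal, if_pos hi, norm_mul, Complex.norm_real,
      Real.norm_of_nonneg (inv_nonneg.2 hi'.le)]
    field_simp
  have h1 := (abs_le.1 (abs_qf_sub_le hb hA hcT ht hBA hzi)).2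
  have h2 := norm_inner_sq_le hB z x
  have h3 : qf A z ≤ ‖(inner ℂ z (B x) : ℂ)‖ := by
    rw [hN2, norm_inner_symm]
    exact Complex.re_le_norm _
  have h4 := qf_nonneg hA z
  have h5 := qf_nonneg hB x
  rw [hN]
  rcases h4.eq_or_lt with h0 | hpos
  · rw [← h0]; positivity
  · have h6 : qf A z * qf A z ≤ qf A z * ((1 + t) * qf B x) := by nlinarith
    exact le_of_mul_le_mul_left h6 hpos

theorem qf_conj_id_sub_comp_diagOp_inv
    (hb : ∀ i, A (b i) = (qf A (b i) : ℂ) • b i) (hB : B.IsPositive)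
    (hT : ∀ i ∈ T, 0 < qf A (b i)) (x : E) :
    qf (conj (ContinuousLinearMap.id ℂ E - B ∘L diagOp b T fun i => (qf A (b i))⁻¹)
      (diagOp b T fun i => qf A (b i))) x =
    qf (diagOp (fun i => (B - A) (b i)) T fun i => (qf A (b i))⁻¹) x := by
  set G := diagOp b T fun i => (qf A (b i))⁻¹ with hG
  have hadj : ContinuousLinearMap.adjoint (ContinuousLinearMap.id ℂ E - B ∘L G) =
      ContinuousLinearMap.id ℂ E - G ∘L B := by
    rw [map_sub, ContinuousLinearMap.adjoint_id, ContinuousLinearMap.adjoint_comp, hG,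
      adjoint_diagOp, hB.isSelfAdjoint.adjoint_eq]
  rw [qf_conj, hadj, qf_diagOp, qf_diagOp]
  refine Finset.sum_congr rfl fun i hi => ?_
  have h1 : (inner ℂ ((B - A) (b i)) x : ℂ) =
      -((qf A (b i) : ℂ) * inner ℂ (b i) ((ContinuousLinearMap.id ℂ E - G ∘L B) x)) := by
    have hBs : (inner ℂ (B (b i)) x : ℂ) = inner ℂ (b i) (B x) := hB.isSymmetric (b i) x
    have hne : (qf A (b i) : ℂ) ≠ 0 := by exact_mod_cast (hT i hi).ne'
    rw [sub_apply, inner_sub_left, hBs, hb i, inner_smul_left, Complex.conj_ofReal, sub_apply,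
      inner_sub_right, ContinuousLinearMap.comp_apply, hG, inner_diagOp b.orthonormal, if_pos hi]
    push_cast
    simp only [id_eq]
    field_simp
    ring
  rw [h1, norm_neg, norm_mul, Complex.norm_real, Real.norm_of_nonneg (hT i hi).le]
  have := hT i hi
  field_simp

theorem tr_diagOp_le (w : ι → E) {c : ι → ℝ} (hc : ∀ i ∈ T, 0 ≤ c i) {M : ℝ}
    (hM : ∀ i ∈ T, ‖w i‖ ^ 2 ≤ M) :
    diagOp w T c ∈ posTC E ∧ tr (diagOp w T c) ≤ (∑ i ∈ T, c i) * M := by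
  induction T using Finset.induction_on with
  | empty => simpa [diagOp, tr_zero] using zero_mem_posTC
  | insert a s ha ih =>
    obtain ⟨h1, h2⟩ := ih (fun i hi => hc i (Finset.mem_insert_of_mem hi))
      (fun i hi => hM i (Finset.mem_insert_of_mem hi))
    have hca := hc a (Finset.mem_insert_self a s)
    have h3 := smul_mem_posTC (rankOne_mem_posTC (w a)) hca
    have h4 : diagOp w (insert a s) c = (c a : ℂ) • rankOne (w a) + diagOp w s c :=
      Finset.sum_insert ha
    rw [h4]
    refine ⟨add_mem_posTC h3 h1, ?_⟩
    rw [tr_add h3 h1, tr_smul (rankOne_mem_posTC _) hca, tr_rankOne, Finset.sum_insert ha, add_mul]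
    gcongr
    exact hM a (Finset.mem_insert_self a s)

end Truncation

section Continuity

universe u

variable {E : Type u} [NormedAddCommGroup E] [InnerProductSpace ℂ E] [CompleteSpace E]
variable {ι : Type*} {b : HilbertBasis ι ℂ E} {T : Finset ι} {A B : E →L[ℂ] E}
variable {K : (E →L[ℂ] E) → ℝ≥0∞}

theorem exists_exp_neg_add_le {t : ℝ} (ht : 0 < t) :
    ∃ v : ℝ, Real.exp (-t) + Real.exp (-v) ≤ 1 := by
  have h : 0 < 1 - Real.exp (-t) := by
    have := Real.exp_lt_one_iff.2 (neg_lt_zero.2 ht)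
    linarith
  exact ⟨-Real.log (1 - Real.exp (-t)), by rw [neg_neg, Real.exp_log h]; linarith⟩

theorem IsEntropyLike.le_of_qf_le (hK : IsEntropyLike K) (hA : A ∈ posTC E) (hB : B ∈ posTC E)
    {c : ℝ} (hc : 0 < c) (h : ∀ x, qf A x ≤ c * qf B x) :
    K A ≤ ENNReal.ofReal c * K B ∧ tr A ≤ c * tr B := by
  have hcB := smul_mem_posTC hB hc.le
  have h' : ∀ x, qf A x ≤ qf ((c : ℂ) • B) x := fun x => by rw [qf_smul]; exact h x
  refine ⟨(hK.mono hA hcB h').trans (hK.smul_le hB hc), ?_⟩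
  rw [← tr_smul hB hc.le]
  exact tr_mono hA hcB h'

/-- Splitting bound in which one of the two parts is negligible. -/
theorem IsEntropyLike.le_of_split (hK : IsEntropyLike K) {W V X Y : E →L[ℂ] E} (hX : X ∈ posTC E)
    (hY : Y ∈ posTC E) (hWV : W + V = ContinuousLinearMap.id ℂ E) {t v c m η : ℝ} (ht : 0 < t)
    (htv : Real.exp (-t) + Real.exp (-v) ≤ 1) (hc : 0 < c)
    (hXY : ∀ x, qf (conj W X) x ≤ c * qf Y x) (hm : 0 ≤ m)
    (hV : K (conj V X) ≤ ENNReal.ofReal (m * η)) (hVt : tr (conj V X) ≤ η)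
    (hη : (1 + t⁻¹) * (m + v) * η ≤ t) :
    K X ≤ ENNReal.ofReal ((1 + t) * c) * K Y + ENNReal.ofReal (t * ((1 + t) * c) * tr Y + t) := by
  obtain ⟨-, hv⟩ := nonneg_of_exp_neg_le htv
  have hη0 : 0 ≤ η := (tr_nonneg _).trans hVt
  obtain ⟨h1, h2⟩ := hK.le_of_qf_le (conj_mem_posTC hX W) hY hc hXY
  have htY := tr_nonneg Y
  have htW := tr_nonneg (conj W X)
  calc K X ≤ ENNReal.ofReal (1 + t) * K (conj W X) + ENNReal.ofReal (1 + t⁻¹) * K (conj V X) +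
        ENNReal.ofReal (t * (1 + t) * tr (conj W X) + v * (1 + t⁻¹) * tr (conj V X)) :=
      hK.split hX hWV ht htv
    _ ≤ ENNReal.ofReal (1 + t) * (ENNReal.ofReal c * K Y) +
        ENNReal.ofReal (1 + t⁻¹) * ENNReal.ofReal (m * η) +
        ENNReal.ofReal (t * (1 + t) * (c * tr Y) + v * (1 + t⁻¹) * η) := by gcongr
    _ = ENNReal.ofReal ((1 + t) * c) * K Y + ENNReal.ofReal ((1 + t⁻¹) * (m * η) +
          (t * (1 + t) * (c * tr Y) + v * (1 + t⁻¹) * η)) := by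
      rw [← mul_assoc, ← ENNReal.ofReal_mul (by positivity), ← ENNReal.ofReal_mul (by positivity),
        add_assoc, ← ENNReal.ofReal_add (by positivity) (by positivity)]
    _ ≤ _ := by
      refine add_le_add le_rfl (ENNReal.ofReal_le_ofReal ?_)
      linarith

theorem exists_pos_forall_le (T : Finset ι) {f : ι → ℝ} (hf : ∀ i ∈ T, 0 < f i) :
    ∃ c : ℝ, 0 < c ∧ ∀ i ∈ T, c ≤ f i := by
  rcases T.eq_empty_or_nonempty with rfl | hT
  · exact ⟨1, one_pos, by simp⟩
  · obtain ⟨j, hj, hmin⟩ := T.exists_min_image f hT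
    exact ⟨f j, hf j hj, hmin⟩

/-- Two-sided comparison of an entropy-like functional at nearby operators with small tails. -/
theorem IsEntropyLike.exists_comparison (hK : IsEntropyLike K) {𝒜 : Set (E →L[ℂ] E)}
    (h𝒜 : 𝒜 ⊆ posTC E) (hA𝒜 : A ∈ 𝒜) (hb : ∀ i, A (b i) = (qf A (b i) : ℂ) • b i)
    (he : ∀ η : ℝ, 0 < η → ∃ T : Finset ι, (∀ i ∈ T, 0 < qf A (b i)) ∧ ∃ δ : ℝ, 0 < δ ∧
      ∀ B ∈ 𝒜, traceNorm (B - A) < ENNReal.ofReal δ →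
        K (conj (coproj b T) B) ≤ ENNReal.ofReal η ∧ tr (conj (coproj b T) B) ≤ η)
    {t : ℝ} (ht : 0 < t) :
    ∃ δ : ℝ, 0 < δ ∧ ∀ B ∈ 𝒜, traceNorm (B - A) < ENNReal.ofReal δ →
      K B ≤ ENNReal.ofReal ((1 + t) ^ 3) * (K A + ENNReal.ofReal (t * (2 * tr A + 3))) ∧
      K A ≤ ENNReal.ofReal ((1 + t) ^ 3) * (K B + ENNReal.ofReal (t * (2 * tr A + 3))) := by
  have hA := h𝒜 hA𝒜
  have htA := tr_nonneg A
  obtain ⟨v, htv⟩ := exists_exp_neg_add_le ht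
  obtain ⟨-, hv⟩ := nonneg_of_exp_neg_le htv
  have hη0 : 0 < t / ((1 + t⁻¹) * (1 + v)) := by positivity
  set η := t / ((1 + t⁻¹) * (1 + v)) with hηdef
  have hη : (1 + t⁻¹) * (1 + v) * η ≤ t := by
    rw [hηdef, mul_div_cancel₀ _ (by positivity)]
  obtain ⟨T, hT, δ₁, hδ₁, hnear⟩ := he η hη0
  obtain ⟨c, hc, hcT⟩ := exists_pos_forall_le T hT
  obtain ⟨m, hm, hmK⟩ := hK.rank_le T.card
  set S := ∑ i ∈ T, (qf A (b i))⁻¹ with hS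
  have hS0 : 0 ≤ S := Finset.sum_nonneg fun i hi => inv_nonneg.2 (hT i hi).le
  set δ₂ := t / ((1 + t⁻¹) * (m + v + 1) * (S + 1)) with hδ₂def
  have hδ₂ : 0 < δ₂ := by positivity
  have hδ₂' : (1 + t⁻¹) * (m + v) * (S * δ₂) ≤ t := by
    have h1 : (1 + t⁻¹) * (m + v + 1) * (S + 1) * δ₂ = t := by
      rw [hδ₂def, mul_div_cancel₀ _ (by positivity)]
    have h2 : (1 + t⁻¹) * (m + v) * (S * δ₂) ≤ (1 + t⁻¹) * (m + v + 1) * ((S + 1) * δ₂) := by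
      have h3 : m + v ≤ m + v + 1 := by linarith
      have h4 : S ≤ S + 1 := by linarith
      gcongr
    linarith
  refine ⟨min (min δ₁ (t * c)) (min δ₂ 1), by positivity, fun B hB𝒜 hBA => ?_⟩
  have hB := h𝒜 hB𝒜
  have hlt : ∀ {δ' : ℝ}, min (min δ₁ (t * c)) (min δ₂ 1) ≤ δ' →
      traceNorm (B - A) < ENNReal.ofReal δ' := fun h => hBA.trans_le (ENNReal.ofReal_le_ofReal h)
  obtain ⟨hKB, htB⟩ := hnear B hB𝒜 (hlt (by simp))
  obtain ⟨hKA, htA'⟩ := hnear A hA𝒜 (by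
    have h0 : traceNorm (A - A) = 0 := by simp [traceNorm]
    rw [h0]; simpa using hδ₁)
  have hn1 : ‖B - A‖ ≤ t * c := (norm_sub_lt (hlt (by simp))).le
  have hn2 : ‖B - A‖ < δ₂ := norm_sub_lt (hlt (by simp))
  have hn3 : ‖B - A‖ < 1 := norm_sub_lt (hlt (by simp))
  have htrB : tr B ≤ tr A + 1 := tr_le_add hA hB zero_le_one (hlt (by simp)).le
  have hQ := proj_add_coproj b T
  have hA'mem : conj (proj b T) A ∈ posTC E := conj_mem_posTC hA _
  -- upper bound
  have hup := hK.le_of_split hB hA hQ ht htv (c := 1 + t) (m := 1) (η := η) (by positivity)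
    (qf_conj_proj_le hb hA.1 hcT ht.le hn1) zero_le_one (by rwa [one_mul]) htB hη
  -- comparison with the compression
  have hlow1 := hK.le_of_split hA hA'mem hQ ht htv (c := 1) (m := 1) (η := η) one_pos
    (fun x => by rw [one_mul]) zero_le_one (by rwa [one_mul]) htA' hη
  have htrA' : tr (conj (proj b T) A) ≤ tr A := tr_mono hA'mem hA fun x => by
    rw [qf_conj, adjoint_proj, ← qf_proj_add_qf_coproj (T := T) hb hA.1 x]
    linarith [qf_nonneg hA.1 (coproj b T x)]
  -- transporting the compression to `B`
  have hlow2 : K (conj (proj b T) A) ≤ ENNReal.ofReal ((1 + t) * (1 + t)) * K B +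
      ENNReal.ofReal (t * ((1 + t) * (1 + t)) * tr B + t) := by
    set V := ContinuousLinearMap.id ℂ E - B ∘L diagOp b T fun i => (qf A (b i))⁻¹ with hV
    have hD := tr_diagOp_le (T := T) (fun i => (B - A) (b i)) (c := fun i => (qf A (b i))⁻¹)
      (M := δ₂) (fun i hi => inv_nonneg.2 (hT i hi).le) fun i _ => by
        have h1 := (B - A).le_opNorm (b i)
        rw [b.orthonormal.1 i, mul_one] at h1
        nlinarith [norm_nonneg ((B - A) (b i)), norm_nonneg (B - A)]
    have hVmem : conj V (conj (proj b T) A) ∈ posTC E := conj_mem_posTC hA'mem _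
    have htrV : tr (conj V (conj (proj b T) A)) ≤ S * δ₂ := by
      refine (tr_mono hVmem hD.1 fun x => ?_).trans hD.2
      rw [conj_proj_eq_diagOp hb, hV, qf_conj_id_sub_comp_diagOp_inv hb hB.1 hT]
    refine hK.le_of_split hA'mem hB (W := B ∘L diagOp b T fun i => (qf A (b i))⁻¹) (V := V)
      (add_sub_cancel _ _) ht htv (by positivity) ?_ hm ?_ htrV hδ₂'
    · rw [conj_proj_eq_diagOp hb]
      exact qf_conj_comp_diagOp_inv_le hb hA.1 hB.1 hc hcT ht.le hn1
    · refine (hmK _ hVmem.1 ?_).trans (ENNReal.ofReal_le_ofReal (by gcongr))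
      rw [conj_proj_eq_diagOp hb]
      exact rankLE_conj (rank_diagOp _ _ _) _ _
  have htB0 := tr_nonneg B
  constructor
  · refine hup.trans ?_
    rw [mul_add (ENNReal.ofReal ((1 + t) ^ 3)), ← ENNReal.ofReal_mul (by positivity)]
    refine add_le_add (mul_le_mul_left (ENNReal.ofReal_le_ofReal ?_) _)
      (ENNReal.ofReal_le_ofReal ?_)
    · nlinarith [pow_pos ht 2, pow_pos ht 3]
    · have h1 : 0 ≤ t * tr A := by positivity
      have h2 : 0 ≤ t ^ 2 * tr A := by positivity
      have h3 : 0 ≤ t ^ 3 * tr A := by positivity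
      have h4 : 0 ≤ t ^ 4 * tr A := by positivity
      nlinarith [pow_pos ht 2, pow_pos ht 3, pow_pos ht 4]
  · have hA'0 := tr_nonneg (conj (proj b T) A)
    calc K A ≤ ENNReal.ofReal ((1 + t) * 1) * K (conj (proj b T) A) +
          ENNReal.ofReal (t * ((1 + t) * 1) * tr (conj (proj b T) A) + t) := hlow1
      _ ≤ ENNReal.ofReal ((1 + t) * 1) * (ENNReal.ofReal ((1 + t) * (1 + t)) * K B +
          ENNReal.ofReal (t * ((1 + t) * (1 + t)) * (tr A + 1) + t)) +
          ENNReal.ofReal (t * ((1 + t) * 1) * tr A + t) := by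
        gcongr
        refine hlow2.trans ?_
        gcongr
      _ = ENNReal.ofReal ((1 + t) ^ 3) * K B + ENNReal.ofReal
          (((1 + t) * 1) * (t * ((1 + t) * (1 + t)) * (tr A + 1) + t) +
            (t * ((1 + t) * 1) * tr A + t)) := by
        rw [mul_add, ← mul_assoc, ← ENNReal.ofReal_mul (by positivity),
          ← ENNReal.ofReal_mul (by positivity), add_assoc,
          ← ENNReal.ofReal_add (by positivity) (by positivity)]
        congr 3
        ring
      _ ≤ _ := by
        rw [mul_add (ENNReal.ofReal ((1 + t) ^ 3)), ← ENNReal.ofReal_mul (by positivity)]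
        refine add_le_add le_rfl (ENNReal.ofReal_le_ofReal ?_)
        have h1 : 0 ≤ t * tr A := by positivity
        have h2 : 0 ≤ t ^ 2 * tr A := by positivity
        have h3 : 0 ≤ t ^ 3 * tr A := by positivity
        have h4 : 0 ≤ t ^ 4 * tr A := by positivity
        nlinarith [pow_pos ht 2, pow_pos ht 3, pow_pos ht 4]

theorem IsEntropyLike.continuousAt (hK : IsEntropyLike K) {𝒜 : Set (E →L[ℂ] E)}
    (h𝒜 : 𝒜 ⊆ posTC E) (hA𝒜 : A ∈ 𝒜) (hfin : K A ≠ ∞)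
    (hb : ∀ i, A (b i) = (qf A (b i) : ℂ) • b i)
    (he : ∀ η : ℝ, 0 < η → ∃ T : Finset ι, (∀ i ∈ T, 0 < qf A (b i)) ∧ ∃ δ : ℝ, 0 < δ ∧
      ∀ B ∈ 𝒜, traceNorm (B - A) < ENNReal.ofReal δ →
        K (conj (coproj b T) B) ≤ ENNReal.ofReal η ∧ tr (conj (coproj b T) B) ≤ η)
    {ε : ℝ} (hε : 0 < ε) :
    ∃ δ : ℝ, 0 < δ ∧ ∀ B ∈ 𝒜, traceNorm (B - A) < ENNReal.ofReal δ →
      |(K B).toReal - (K A).toReal| < ε := by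
  have htA := tr_nonneg A
  set a := (K A).toReal with ha
  set M := 2 * tr A + 3 with hM
  have hM0 : 0 ≤ M := by positivity
  have ha0 : 0 ≤ a := ENNReal.toReal_nonneg
  obtain ⟨t, ht, ht1⟩ : ∃ t : ℝ, 0 < t ∧ (1 + t) ^ 3 * (a + min ε 1 + t * M) < a + min ε 1 + min ε 1 := by
    have hcont : Continuous fun t : ℝ => (1 + t) ^ 3 * (a + min ε 1 + t * M) := by fun_prop
    have h0 : (1 + (0 : ℝ)) ^ 3 * (a + min ε 1 + 0 * M) < a + min ε 1 + min ε 1 := by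
      have : 0 < min ε 1 := by positivity
      linarith
    have hev := (hcont.tendsto 0).eventually_lt_const h0
    have hev' : ∀ᶠ t in 𝓝[>] (0 : ℝ), (1 + t) ^ 3 * (a + min ε 1 + t * M) < a + min ε 1 + min ε 1 :=
      nhdsWithin_le_nhds hev
    obtain ⟨t, h1, h2⟩ := (hev'.and self_mem_nhdsWithin).exists
    exact ⟨t, h2, h1⟩
  obtain ⟨δ, hδ, h⟩ := hK.exists_comparison h𝒜 hA𝒜 hb he ht
  refine ⟨δ, hδ, fun B hB hBA => ?_⟩
  obtain ⟨h1, h2⟩ := h B hB hBA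
  have hfin1 : ENNReal.ofReal ((1 + t) ^ 3) * (K A + ENNReal.ofReal (t * M)) ≠ ∞ :=
    ENNReal.mul_ne_top ENNReal.ofReal_ne_top (ENNReal.add_ne_top.2 ⟨hfin, ENNReal.ofReal_ne_top⟩)
  have hBfin : K B ≠ ∞ := ne_top_of_le_ne_top hfin1 h1
  have hfin2 : ENNReal.ofReal ((1 + t) ^ 3) * (K B + ENNReal.ofReal (t * M)) ≠ ∞ :=
    ENNReal.mul_ne_top ENNReal.ofReal_ne_top (ENNReal.add_ne_top.2 ⟨hBfin, ENNReal.ofReal_ne_top⟩)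
  have h1' := ENNReal.toReal_mono hfin1 h1
  have h2' := ENNReal.toReal_mono hfin2 h2
  rw [ENNReal.toReal_mul, ENNReal.toReal_ofReal (by positivity),
    ENNReal.toReal_add hfin ENNReal.ofReal_ne_top, ENNReal.toReal_ofReal (by positivity)] at h1'
  rw [ENNReal.toReal_mul, ENNReal.toReal_ofReal (by positivity),
    ENNReal.toReal_add hBfin ENNReal.ofReal_ne_top, ENNReal.toReal_ofReal (by positivity)] at h2'
  rw [← ha] at h1' h2'
  set e := min ε 1 with he1
  have he0 : 0 < e := by positivity
  have hee : e ≤ ε := min_le_left _ _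
  have ht3 : 1 ≤ (1 + t) ^ 3 := one_le_pow₀ (by linarith)
  rw [abs_lt]
  constructor
  · by_contra hcon
    push Not at hcon
    have h3 : (K B).toReal ≤ a - e := by linarith
    have h4 : (1 + t) ^ 3 * ((K B).toReal + t * M) ≤ (1 + t) ^ 3 * (a - e + t * M) := by gcongr
    nlinarith
  · nlinarith

end Continuity

section Tails

universe u v

variable {E : Type u} [NormedAddCommGroup E] [InnerProductSpace ℂ E] [CompleteSpace E]
variable {F : Type v} [NormedAddCommGroup F] [InnerProductSpace ℂ F] [CompleteSpace F]
variable {ι : Type*} {b : HilbertBasis ι ℂ E} {A : E →L[ℂ] E}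

theorem exists_finset_tsum_ite_le {g : ι → ℝ≥0∞} (hg : ∑' i, g i ≠ ∞) {p : ι → Prop}
    (hp : ∀ i, ¬ p i → g i = 0) {η : ℝ} (hη : 0 < η) :
    ∃ T : Finset ι, (∀ i ∈ T, p i) ∧ ∑' i, (if i ∈ T then 0 else g i) ≤ ENNReal.ofReal η := by
  have h := (ENNReal.tendsto_tsum_compl_atTop_zero hg).eventually_le_const
    (ENNReal.ofReal_pos.2 hη)
  obtain ⟨S, hS⟩ := h.exists
  refine ⟨S.filter p, fun i hi => (Finset.mem_filter.1 hi).2, le_trans ?_ hS⟩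
  rw [← tsum_subtype_eq_of_support_subset (s := {i | i ∉ S}) fun i hi => ?_]
  · refine ENNReal.tsum_le_tsum fun i => ?_
    split_ifs <;> simp
  · intro hiS
    rw [Function.mem_support] at hi
    refine hi ?_
    split_ifs with h1
    · rfl
    · exact hp i fun hpi => h1 (Finset.mem_filter.2 ⟨hiS, hpi⟩)

theorem qf_conj_coproj_basis (T : Finset ι) (B : E →L[ℂ] E) (i : ι) :
    qf (conj (coproj b T) B) (b i) = if i ∈ T then 0 else qf B (b i) := by
  rw [qf_conj, adjoint_coproj, coproj_apply_basis]
  split_ifs <;> simp [qf]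

theorem exists_finset_tail (hA : A ∈ posTC E) (hb : ∀ i, A (b i) = (qf A (b i) : ℂ) • b i)
    {η : ℝ} (hη : 0 < η) :
    ∃ T : Finset ι, (∀ i ∈ T, 0 < qf A (b i)) ∧ tr (conj (coproj b T) A) ≤ η ∧
      (qEntropy A ≠ ∞ → qEntropy (conj (coproj b T) A) ≤ ENNReal.ofReal η) := by
  have hl : ∀ i, 0 ≤ qf A (b i) := fun i => qf_nonneg hA.1 _
  have htr := hasSum_tr b hA
  set g : ι → ℝ≥0∞ := fun i => ENNReal.ofReal (qf A (b i)) +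
    (if qEntropy A = ∞ then 0 else ENNReal.ofReal (entTerm (tr A) (qf A (b i)))) with hgdef
  have hg : ∑' i, g i ≠ ∞ := by
    rw [hgdef, ENNReal.tsum_add, tsum_ofReal_of_hasSum hl htr]
    refine ENNReal.add_ne_top.2 ⟨ENNReal.ofReal_ne_top, ?_⟩
    split_ifs with h
    · simp
    · rwa [← htr.tsum_eq, ← clEntropy_eq hl htr.summable, ← qEntropy_eq hA hb]
  obtain ⟨T, hT, hsum⟩ := exists_finset_tsum_ite_le hg (p := fun i => 0 < qf A (b i))
    (fun i hi => by
      have h0 : qf A (b i) = 0 := le_antisymm (not_lt.1 hi) (hl i)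
      simp [hgdef, h0, entTerm_zero_right]) hη
  refine ⟨T, hT, ?_, fun hfin => ?_⟩
  · rw [← ENNReal.ofReal_le_ofReal_iff hη.le]
    refine le_trans (le_of_eq_of_le
      (tsum_ofReal_of_hasSum (fun i => ?_) (hasSum_tr_conj_coproj hA)).symm ?_) hsum
    · split_ifs
      exacts [le_rfl, hl i]
    · refine ENNReal.tsum_le_tsum fun i => ?_
      split_ifs
      · simp
      · exact le_self_add
  · have hc := conj_mem_posTC hA (coproj b T)
    have hcs := hasSum_tr b hc
    refine (qEntropy_le_clEntropy b _).trans ?_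
    rw [clEntropy_eq (fun i => qf_nonneg hc.1 _) hcs.summable, hcs.tsum_eq]
    refine (ENNReal.tsum_le_tsum fun i => ?_).trans hsum
    rw [qf_conj_coproj_basis]
    split_ifs with hi
    · simp [entTerm_zero_right]
    · simp only [hgdef, if_neg hfin]
      refine le_trans (ENNReal.ofReal_le_ofReal ?_) le_add_self
      rcases (hl i).eq_or_lt with h0 | h0
      · simp [← h0, entTerm_zero_right]
      · have h1 : qf A (b i) ≤ tr (conj (coproj b T) A) := by
          have := le_hasSum hcs i fun j _ => qf_nonneg hc.1 _
          rwa [qf_conj_coproj_basis, if_neg hi] at this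
        have h2 : tr (conj (coproj b T) A) ≤ tr A := tr_mono hc hA fun x => by
          rw [qf_conj, adjoint_coproj, ← qf_proj_add_qf_coproj (T := T) hb hA.1 x]
          linarith [qf_nonneg hA.1 (proj b T x)]
        unfold entTerm
        have h3 := Real.log_le_log (h0.trans_le h1) h2
        gcongr

variable {𝒜 : Set (E →L[ℂ] E)}

theorem exists_uniform_trace_tail (h𝒜 : 𝒜 ⊆ posTC E) (hA : A ∈ posTC E)
    (hb : ∀ i, A (b i) = (qf A (b i) : ℂ) • b i) {η : ℝ} (hη : 0 < η) :
    ∃ T : Finset ι, (∀ i ∈ T, 0 < qf A (b i)) ∧ ∃ δ : ℝ, 0 < δ ∧ ∀ B ∈ 𝒜,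
      traceNorm (B - A) < ENNReal.ofReal δ → tr (conj (coproj b T) B) ≤ η := by
  obtain ⟨T, hT, htr, -⟩ := exists_finset_tail hA hb (half_pos hη)
  refine ⟨T, hT, η / 2, half_pos hη, fun B hB hBA => ?_⟩
  have := tr_conj_coproj_le (b := b) (T := T) hA (h𝒜 hB) (half_pos hη).le hBA.le
  linarith

theorem exists_uniform_entropy_tail (h𝒜 : 𝒜 ⊆ posTC E) (hcont : ContOn qEntropy 𝒜) (hA𝒜 : A ∈ 𝒜)
    (hb : ∀ i, A (b i) = (qf A (b i) : ℂ) • b i) {η : ℝ} (hη : 0 < η) :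
    ∃ T : Finset ι, (∀ i ∈ T, 0 < qf A (b i)) ∧ ∃ δ : ℝ, 0 < δ ∧ ∀ B ∈ 𝒜,
      traceNorm (B - A) < ENNReal.ofReal δ →
        qEntropy (conj (coproj b T) B) ≤ ENNReal.ofReal η ∧ tr (conj (coproj b T) B) ≤ η := by
  have hA := h𝒜 hA𝒜
  have hAfin := hcont.1 A hA𝒜
  have htA := tr_nonneg A
  set h := (qEntropy A).toReal with hh
  have hh0 : 0 ≤ h := ENNReal.toReal_nonneg
  have hu : 0 < η / (4 * (tr A + 1)) := by positivity
  set u := η / (4 * (tr A + 1)) with hudef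
  have hu' : u * tr A ≤ η / 4 := by
    have : u * (tr A + 1) = η / 4 := by rw [hudef]; field_simp
    nlinarith
  obtain ⟨v, huv⟩ := exists_exp_neg_add_le hu
  obtain ⟨-, hv⟩ := nonneg_of_exp_neg_le huv
  set η' := η / (4 * (2 + v)) with hη'def
  have hη' : 0 < η' := by positivity
  have hη'' : (2 + v) * η' = η / 4 := by rw [hη'def]; field_simp
  have hs : 0 < min 1 (η / (4 * (h + 1))) := by positivity
  set s := min 1 (η / (4 * (h + 1))) with hsdef
  have hs1 : s ≤ 1 := min_le_left _ _
  have hsh : s * h ≤ η / 4 := by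
    have h1 : s * (h + 1) ≤ η / (4 * (h + 1)) * (h + 1) := by gcongr; exact min_le_right _ _
    have h2 : η / (4 * (h + 1)) * (h + 1) = η / 4 := by field_simp
    nlinarith
  obtain ⟨T, hT, htrT, hHT⟩ := exists_finset_tail hA hb hη'
  have hHT := hHT hAfin
  obtain ⟨c, hc, hcT⟩ := exists_pos_forall_le T hT
  obtain ⟨δ₁, hδ₁, hnear⟩ := hcont.2 A hA𝒜 η' hη'
  refine ⟨T, hT, min δ₁ (min (s * c) η'), by positivity, fun B hB𝒜 hBA => ?_⟩
  have hB := h𝒜 hB𝒜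
  have hBfin := hcont.1 B hB𝒜
  have hlt : ∀ {δ' : ℝ}, min δ₁ (min (s * c) η') ≤ δ' →
      traceNorm (B - A) < ENNReal.ofReal δ' := fun h => hBA.trans_le (ENNReal.ofReal_le_ofReal h)
  have hHB := abs_lt.1 (hnear B hB𝒜 (hlt (by simp)))
  have hn : ‖B - A‖ ≤ s * c := (norm_sub_lt (hlt (by simp))).le
  have htrB := tr_conj_coproj_le (b := b) (T := T) hA hB hη'.le (hlt (by simp)).le
  have hvη : 0 ≤ v * η' := by positivity
  refine ⟨?_, by nlinarith⟩
  have hQA : conj (proj b T) A ∈ posTC E := conj_mem_posTC hA _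
  have hQB : conj (proj b T) B ∈ posTC E := conj_mem_posTC hB _
  have hPA : conj (coproj b T) A ∈ posTC E := conj_mem_posTC hA _
  have hqle : ∀ x, qf (conj (proj b T) A) x ≤ qf A x := fun x => by
    rw [qf_conj, adjoint_proj, ← qf_proj_add_qf_coproj (T := T) hb hA.1 x]
    linarith [qf_nonneg hA.1 (coproj b T x)]
  have hsplit : qEntropy (conj (proj b T) B) + qEntropy (conj (coproj b T) B) ≤ qEntropy B :=
    qEntropy_conj_add_le hB (norm_sq_proj_add b T)
  have hcmp : ENNReal.ofReal (1 - s) * qEntropy (conj (proj b T) A) ≤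
      qEntropy (conj (proj b T) B) := by
    rw [← qEntropy_smul hQA (by linarith)]
    refine qEntropy_mono (smul_mem_posTC hQA (by linarith)).1 hQB fun x => ?_
    rw [qf_smul]
    exact le_qf_conj_proj hb hA.1 hcT hs.le hn x
  have hadd : qEntropy A ≤ qEntropy (conj (proj b T) A) + ENNReal.ofReal η' +
      ENNReal.ofReal (u * tr A + v * η') := by
    have h1 : qEntropy A ≤ qEntropy (conj (proj b T) A + conj (coproj b T) A) :=
      qEntropy_mono hA.1 (add_mem_posTC hQA hPA) fun x => by
        rw [qf_add, qf_conj, qf_conj, adjoint_proj, adjoint_coproj,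
          qf_proj_add_qf_coproj hb hA.1]
    refine h1.trans ((qEntropy_add_le hQA hPA huv).trans ?_)
    have h2 := tr_mono hQA hA hqle
    gcongr
  have hQAfin : qEntropy (conj (proj b T) A) ≠ ∞ :=
    ne_top_of_le_ne_top hAfin (qEntropy_mono hQA.1 hA hqle)
  have hQAle := ENNReal.toReal_mono hAfin (qEntropy_mono hQA.1 hA hqle)
  have hfs := ne_top_of_le_ne_top hBfin hsplit
  obtain ⟨hQBfin, hPBfin⟩ := ENNReal.add_ne_top.1 hfs
  have hsplit' := ENNReal.toReal_mono hBfin hsplit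
  have hcmp' := ENNReal.toReal_mono hQBfin hcmp
  have hadd' := ENNReal.toReal_mono (by finiteness) hadd
  rw [ENNReal.toReal_add hQBfin hPBfin] at hsplit'
  rw [ENNReal.toReal_mul, ENNReal.toReal_ofReal (by linarith)] at hcmp'
  rw [ENNReal.toReal_add (by finiteness) (by finiteness), ENNReal.toReal_add hQAfin (by finiteness),
    ENNReal.toReal_ofReal hη'.le, ENNReal.toReal_ofReal (by positivity)] at hadd'
  rw [ENNReal.le_ofReal_iff_toReal_le hPBfin hη.le]
  have h5 := mul_le_mul_of_nonneg_left hQAle hs.le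
  nlinarith [hHB.2]

variable {Φ : TraceMap E F}

theorem TraceMap.TNI.pce_of_bdd (hΦ : Φ.TNI) {C : ℝ} (hC0 : 0 ≤ C)
    (hC : ∀ ρ ∈ pureStates E, outEntropy Φ ρ ≤ ENNReal.ofReal C) : PCE Φ.toFun := by
  intro 𝒜 h𝒜 hcont
  change ContOn (outEntropy Φ) 𝒜
  have hfin : ∀ A ∈ 𝒜, outEntropy Φ A ≠ ∞ := fun A hA => by
    have hHA := hcont.1 A hA
    exact ne_top_of_le_ne_top (by finiteness) (hΦ.outEntropy_le hC (h𝒜 hA))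
  refine ⟨hfin, fun A hA𝒜 ε hε => ?_⟩
  obtain ⟨ι, b, hb⟩ := exists_eigenbasis (h𝒜 hA𝒜)
  refine (hΦ.outEntropy_isEntropyLike hC0 hC).continuousAt h𝒜 hA𝒜 (hfin A hA𝒜) hb
    (fun η hη => ?_) hε
  have hη' : 0 < η / (C + 1) := by positivity
  obtain ⟨T, hT, δ, hδ, h⟩ := exists_uniform_entropy_tail h𝒜 hcont hA𝒜 hb hη'
  have hle : C * (η / (C + 1)) + η / (C + 1) = η := by field_simp
  refine ⟨T, hT, δ, hδ, fun B hB hBA => ?_⟩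
  obtain ⟨h1, h2⟩ := h B hB hBA
  refine ⟨(hΦ.outEntropy_le hC (conj_mem_posTC (h𝒜 hB) _)).trans ?_, h2.trans ?_⟩
  · rw [← hle, ENNReal.ofReal_add (by positivity) hη'.le, ENNReal.ofReal_mul hC0]
    gcongr
  · have : 0 ≤ C * (η / (C + 1)) := by positivity
    linarith

theorem eq_zero_of_rankLE_zero {X : E →L[ℂ] E} (h : rankLE X 0) : X = 0 := by
  have h1 : Module.rank ℂ (LinearMap.range (X : E →ₗ[ℂ] E)) = 0 := by
    simpa [rankLE] using h
  have h2 := LinearMap.range_eq_bot.1 (Submodule.rank_eq_zero.1 h1)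
  ext x
  exact congrArg (fun f : E →ₗ[ℂ] E => f x) h2

theorem kApprox_zero (A : E →L[ℂ] E) : kApprox Φ.toFun 0 A = 0 := by
  refine le_antisymm (kApprox_le_of_forall fun Y _ hrank _ => ?_) zero_le
  simp [fun i => eq_zero_of_rankLE_zero (hrank i), outEntropy_zero]

theorem TraceMap.TNI.kApprox_contOn_of_bdd (hΦ : Φ.TNI) {C : ℝ} (hC0 : 0 ≤ C)
    (hC : ∀ ρ ∈ pureStates E, outEntropy Φ ρ ≤ ENNReal.ofReal C) (k : ℕ) :
    ContOn (kApprox Φ.toFun k) (posTC E) := by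
  have hfin : ∀ A ∈ posTC E, kApprox Φ.toFun k A ≠ ∞ := fun A hA =>
    ne_top_of_le_ne_top ENNReal.ofReal_ne_top (hΦ.kApprox_le hC0 hC hA)
  refine ⟨hfin, fun A hA ε hε => ?_⟩
  rcases Nat.eq_zero_or_pos k with rfl | hk
  · exact ⟨1, one_pos, fun B _ _ => by simpa [kApprox_zero] using hε⟩
  obtain ⟨ι, b, hb⟩ := exists_eigenbasis hA
  refine (hΦ.kApprox_isEntropyLike hC0 hC hk).continuousAt subset_rfl hA (hfin A hA) hb
    (fun η hη => ?_) hε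
  have hη' : 0 < η / (C + k + 1) := by positivity
  obtain ⟨T, hT, δ, hδ, h⟩ := exists_uniform_trace_tail subset_rfl hA hb hη'
  have hle : (C + k) * (η / (C + k + 1)) + η / (C + k + 1) = η := by field_simp
  have h0 : 0 ≤ (C + k) * (η / (C + k + 1)) := by positivity
  refine ⟨T, hT, δ, hδ, fun B hB hBA => ?_⟩
  have h1 := h B hB hBA
  refine ⟨(hΦ.kApprox_le hC0 hC (conj_mem_posTC hB _)).trans (ENNReal.ofReal_le_ofReal ?_),
    by linarith⟩
  have h2 : (C + k) * tr (conj (coproj b T) B) ≤ (C + k) * (η / (C + k + 1)) := by gcongr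
  linarith

theorem bddOn_of_contOn {K : (E →L[ℂ] E) → ℝ≥0∞} (hcont : ContOn K 𝒜) (h𝒜 : rankCone E 1 ⊆ 𝒜)
    (hK : ∀ X ∈ rankCone E 1, outEntropy Φ X ≤ K X) : BddOn (outEntropy Φ) (pureStates E) := by
  have h0 : (0 : E →L[ℂ] E) ∈ 𝒜 := h𝒜 ⟨zero_mem_posTC.1, rankLE_zero 1⟩
  obtain ⟨δ, hδ, h⟩ := hcont.2 0 h0 1 one_pos
  have hδ2 : 0 < δ / 2 := half_pos hδ
  refine ⟨(δ / 2)⁻¹ * ((K 0).toReal + 1), ?_⟩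
  rintro _ ⟨x, hx, rfl⟩
  have hx1 := rankOne_mem_posTC x
  have hX := smul_mem_posTC hx1 hδ2.le
  have hXc : ((δ / 2 : ℝ) : ℂ) • rankOne x ∈ rankCone E 1 :=
    ⟨hX.1, rankLE_smul (rankLE_rankOne x) _⟩
  have hnorm : traceNorm (((δ / 2 : ℝ) : ℂ) • rankOne x - 0) < ENNReal.ofReal δ := by
    rw [sub_zero]
    refine (traceNorm_le_traceENN hX.1).trans_lt ?_
    rw [← ofReal_tr hX, tr_smul hx1 hδ2.le, tr_rankOne, hx]
    exact (ENNReal.ofReal_lt_ofReal_iff hδ).2 (by linarith)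
  have h1 := (abs_lt.1 (h _ (h𝒜 hXc) hnorm)).2
  have h2 : outEntropy Φ (((δ / 2 : ℝ) : ℂ) • rankOne x) ≤ ENNReal.ofReal ((K 0).toReal + 1) := by
    refine (hK _ hXc).trans ?_
    rw [ENNReal.le_ofReal_iff_toReal_le (hcont.1 _ (h𝒜 hXc))
      (add_nonneg ENNReal.toReal_nonneg zero_le_one)]
    linarith
  rw [outEntropy_smul hx1 hδ2.le] at h2
  rw [ENNReal.ofReal_mul (by positivity)]
  calc outEntropy Φ (rankOne x) =
      ENNReal.ofReal (δ / 2)⁻¹ * (ENNReal.ofReal (δ / 2) * outEntropy Φ (rankOne x)) := by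
        rw [← mul_assoc, ← ENNReal.ofReal_mul (by positivity), inv_mul_cancel₀ hδ2.ne']
        simp
    _ ≤ _ := by gcongr

theorem contOn_qEntropy_rankCone_one : ContOn qEntropy (rankCone E 1) := by
  have h : ∀ X ∈ rankCone E 1, qEntropy X = 0 := fun X hX => qEntropy_eq_zero hX.1 hX.2
  refine ⟨fun A hA => by simp [h A hA], fun A hA ε hε => ⟨1, one_pos, fun B hB _ => ?_⟩⟩
  simpa [h A hA, h B hB] using hε

theorem ContOn.mono {f : (E →L[ℂ] E) → ℝ≥0∞} {ℬ : Set (E →L[ℂ] E)} (h : ContOn f ℬ)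
    (h𝒜 : 𝒜 ⊆ ℬ) : ContOn f 𝒜 :=
  ⟨fun A hA => h.1 A (h𝒜 hA), fun A hA ε hε => by
    obtain ⟨δ, hδ, h'⟩ := h.2 A (h𝒜 hA) ε hε
    exact ⟨δ, hδ, fun B hB => h' B (h𝒜 hB)⟩⟩

end Tails

/-- Theorem 2 of the paper. For a positive linear trace-non-increasing
map `Φ`, the following are equivalent: (i) the output entropy is continuous on the set
of positive operators of rank ≤ 1; (ii) every `k`-order approximator `H_Φᵏ` is
continuous on `𝔗₊(ℋ)`; (iii) the output entropy is continuous on every subset of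
`𝔗₊(ℋ)` on which the quantum entropy is continuous (`Φ` is a PCE-map).  Moreover, (i)
is equivalent to continuity and boundedness of the output entropy on the set of pure
states. -/
theorem statement10
    {E F : Type*}
    [NormedAddCommGroup E] [InnerProductSpace ℂ E] [CompleteSpace E]
    [TopologicalSpace.SeparableSpace E]
    [NormedAddCommGroup F] [InnerProductSpace ℂ F] [CompleteSpace F]
    [TopologicalSpace.SeparableSpace F]
    (Φ : TraceMap E F) (hΦ : Φ.TNI) :
    List.TFAE
      [ ContOn (outEntropy Φ) (rankCone E 1),
        ∀ k : ℕ, ContOn (kApprox Φ.toFun k) (posTC E),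
        PCE Φ.toFun,
        ContOn (outEntropy Φ) (pureStates E) ∧ BddOn (outEntropy Φ) (pureStates E) ] := by
  have hsub : rankCone E 1 ⊆ posTC E := fun X hX => mem_posTC_of_rankLE hX.1 hX.2
  have hbdd : BddOn (outEntropy Φ) (pureStates E) →
      ∃ C : ℝ, 0 ≤ C ∧ ∀ ρ ∈ pureStates E, outEntropy Φ ρ ≤ ENNReal.ofReal C := by
    rintro ⟨C, hC⟩
    exact ⟨max C 0, le_max_right _ _, fun ρ hρ =>
      (hC ρ hρ).trans (ENNReal.ofReal_le_ofReal (le_max_left _ _))⟩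
  tfae_have 1 → 4 := fun h => by
    refine ⟨h.mono ?_, bddOn_of_contOn h subset_rfl fun X _ => le_rfl⟩
    rintro _ ⟨x, -, rfl⟩
    exact ⟨rankOne_isPositive x, rankLE_rankOne x⟩
  tfae_have 4 → 2 := fun h k => by
    obtain ⟨C, hC0, hC⟩ := hbdd h.2
    exact hΦ.kApprox_contOn_of_bdd hC0 hC k
  tfae_have 2 → 3 := fun h => by
    obtain ⟨C, hC0, hC⟩ := hbdd (bddOn_of_contOn (h 1) hsub fun X hX => by
      have := tsum_outEntropy_le_kApprox (Φ := Φ) (k := 1) (Y := fun _ : Unit => X)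
        (fun _ => hX.1) (fun _ => hX.2) (hasSum_unique _)
      simpa using this)
    exact hΦ.pce_of_bdd hC0 hC
  tfae_have 3 → 1 := fun h => h _ hsub contOn_qEntropy_rankCone_one
  tfae_finish

end QIT
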